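/- arXiv:2112.10835 — 3 statements merged into one kernel-verified Lean document; each statement's English description precedes it below -/
import Mathlib

section
/- Let β₁ ∈ (0,2) and β₂ ∈ ℝ, and define the Mittag-Leffler function E_{β₁,β₂}(x) := ∑_{k=0}^∞ x^k · (Γ(β₁ k + β₂))⁻¹ for x ∈ ℝ. Then there exists a constant c > 0, depending only on β₁ and β₂, such that |E_{β₁,β₂}(τ)| ≤ c / (1 + |τ|) for every τ ≤ 0. -/
open Real

open MeasureTheory Set Filter Topology FourierTransform

/-- The Laplace transform of `t ^ (s - 1)` at a complex argument in the right half-plane. -/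
theorem integral_rpow_mul_cexp_neg_mul_Ioi {s : ℝ} (hs : 1 ≤ s) {r : ℂ} (hr : 0 < r.re) :
    ∫ t in Ioi (0 : ℝ), ((t ^ (s - 1) : ℝ) : ℂ) * Complex.exp (-(r * t)) =
      (1 / r) ^ (s : ℂ) * (Real.Gamma s : ℂ) := by
  have hU : IsOpen {z : ℂ | 0 < z.re} := isOpen_lt continuous_const Complex.continuous_re
  have hint : ∀ {a b : ℝ}, -1 < a → 0 < b →
      IntegrableOn (fun t : ℝ => t ^ a * Real.exp (-b * t)) (Ioi 0) := by
    intro a b ha hb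
    simpa using integrableOn_rpow_mul_exp_neg_mul_rpow ha one_pos hb
  have hmeas : ∀ z : ℂ, AEStronglyMeasurable
      (fun t : ℝ => ((t ^ (s - 1) : ℝ) : ℂ) * Complex.exp (-(z * t)))
      (volume.restrict (Ioi 0)) := by
    intro z
    apply Measurable.aestronglyMeasurable
    fun_prop
  have hnorm : ∀ (z : ℂ) {t : ℝ}, 0 < t → ∀ a : ℝ,
      ‖((t ^ a : ℝ) : ℂ) * Complex.exp (-(z * t))‖ = t ^ a * Real.exp (-z.re * t) := by
    intro z t ht a
    rw [norm_mul, Complex.norm_real, Complex.norm_exp, Real.norm_of_nonneg (by positivity)]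
    simp
  have hdiff : DifferentiableOn ℂ
      (fun z : ℂ => ∫ t in Ioi (0 : ℝ), ((t ^ (s - 1) : ℝ) : ℂ) * Complex.exp (-(z * t)))
      {z : ℂ | 0 < z.re} := by
    intro z hz
    have hz : 0 < z.re := hz
    have hnhds : {w : ℂ | z.re / 2 < w.re} ∈ 𝓝 z :=
      (isOpen_lt continuous_const Complex.continuous_re).mem_nhds (by simp; linarith)
    refine (hasDerivAt_integral_of_dominated_loc_of_deriv_le hnhds
      (F' := fun w t => -(((t ^ s : ℝ) : ℂ) * Complex.exp (-(w * t))))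
      (bound := fun t => t ^ s * Real.exp (-(z.re / 2) * t))
      (Eventually.of_forall hmeas) ?_ ?_ ?_ (hint (by linarith) (by linarith))
      ?_).2.differentiableAt.differentiableWithinAt
    · refine (hint (a := s - 1) (b := z.re) (by linarith) hz).mono' (hmeas z) ?_
      filter_upwards [ae_restrict_mem measurableSet_Ioi] with t ht
      exact (hnorm z ht _).le
    · apply Measurable.aestronglyMeasurable
      fun_prop
    · filter_upwards [ae_restrict_mem measurableSet_Ioi] with t ht w hw
      have ht : 0 < t := ht
      have hw : z.re / 2 < w.re := hw
      rw [norm_neg, hnorm w ht]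
      gcongr
    · filter_upwards [ae_restrict_mem measurableSet_Ioi] with t ht w _
      have ht : 0 < t := ht
      have h1 : HasDerivAt (fun w : ℂ => Complex.exp (-(w * t)))
          (Complex.exp (-(w * t)) * (-(1 * t))) w :=
        ((hasDerivAt_id w).mul_const (t : ℂ)).neg.cexp
      refine (h1.const_mul _).congr_deriv ?_
      have h2 : t ^ s = t ^ (s - 1) * t := by
        rw [← Real.rpow_add_one ht.ne']; simp
      rw [h2]; push_cast; ring
  have hdiff' : DifferentiableOn ℂ (fun z : ℂ => (1 / z) ^ (s : ℂ) * (Real.Gamma s : ℂ))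
      {z : ℂ | 0 < z.re} := by
    intro z hz
    have hz : 0 < z.re := hz
    have hz0 : z ≠ 0 := by rintro rfl; simp at hz
    have h1 : 1 / z ∈ Complex.slitPlane := by
      left
      rw [one_div, Complex.inv_re]
      exact div_pos hz (Complex.normSq_pos.2 hz0)
    have h2 : DifferentiableAt ℂ (fun z : ℂ => 1 / z) z := by fun_prop (disch := assumption)
    exact ((h2.cpow_const h1).mul_const _).differentiableWithinAt
  have hconn : IsPreconnected {z : ℂ | 0 < z.re} := (convex_halfSpace_re_gt 0).isPreconnected
  refine (hdiff.analyticOnNhd hU).eqOn_of_preconnected_of_frequently_eq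
    (hdiff'.analyticOnNhd hU) hconn (z₀ := 1) (by simp) ?_ hr
  have hreal : ∀ x : ℝ, 0 < x →
      ∫ t in Ioi (0 : ℝ), ((t ^ (s - 1) : ℝ) : ℂ) * Complex.exp (-((x : ℂ) * t)) =
      (1 / (x : ℂ)) ^ (s : ℂ) * (Real.Gamma s : ℂ) := by
    intro x hx
    have := Real.integral_rpow_mul_exp_neg_mul_Ioi (a := s) (by linarith) hx
    have h2 := congrArg (fun y : ℝ => (y : ℂ)) this
    rw [← integral_complex_ofReal, Complex.ofReal_mul, Complex.ofReal_cpow (by positivity)] at h2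
    push_cast at h2
    exact h2
  have htend : Tendsto (fun n : ℕ => (((1 + 1 / ((n : ℝ) + 1) : ℝ)) : ℂ)) atTop (𝓝[≠] 1) := by
    refine tendsto_nhdsWithin_iff.2 ⟨?_, Eventually.of_forall fun n => ?_⟩
    · have h := (tendsto_one_div_add_atTop_nhds_zero_nat (𝕜 := ℝ)).const_add 1
      simpa [Function.comp_def] using (Complex.continuous_ofReal.tendsto _).comp h
    · have : (0 : ℝ) < 1 / ((n : ℝ) + 1) := by positivity
      simp only [mem_compl_iff, mem_singleton_iff]
      intro h
      have : (1 + 1 / ((n : ℝ) + 1) : ℝ) = 1 := by exact_mod_cast h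
      linarith
  exact htend.frequently (Frequently.of_forall fun n => hreal _ (by positivity))

/-- The points of the vertical line `Re ζ = 1`. -/
noncomputable def verticalLine (ξ : ℝ) : ℂ := 1 + 2 * π * ξ * Complex.I

theorem verticalLine_re (ξ : ℝ) : (verticalLine ξ).re = 1 := by simp [verticalLine]

theorem verticalLine_im (ξ : ℝ) : (verticalLine ξ).im = 2 * π * ξ := by simp [verticalLine]

theorem verticalLine_ne_zero (ξ : ℝ) : verticalLine ξ ≠ 0 := fun h => by
  simpa [h] using verticalLine_re ξ

theorem continuous_verticalLine : Continuous verticalLine := by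
  unfold verticalLine; fun_prop

theorem one_div_verticalLine_re_pos (ξ : ℝ) : 0 < (1 / verticalLine ξ).re := by
  rw [one_div, Complex.inv_re, verticalLine_re]
  exact one_div_pos.2 (Complex.normSq_pos.2 (verticalLine_ne_zero ξ))

theorem norm_one_div_verticalLine_le_one (ξ : ℝ) : ‖1 / verticalLine ξ‖ ≤ 1 := by
  have h := Complex.abs_re_le_norm (verticalLine ξ)
  rw [verticalLine_re, abs_one] at h
  rw [norm_div, norm_one]
  exact div_le_one_of_le₀ h (norm_nonneg _)

theorem continuous_one_div_verticalLine_cpow (s : ℝ) :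
    Continuous fun ξ : ℝ => (1 / verticalLine ξ) ^ (s : ℂ) :=
  (continuous_const.div continuous_verticalLine verticalLine_ne_zero).cpow continuous_const
    fun ξ => Or.inl (one_div_verticalLine_re_pos ξ)

theorem norm_one_div_verticalLine_cpow_le {s : ℝ} (hs : 2 ≤ s) (ξ : ℝ) :
    ‖(1 / verticalLine ξ) ^ (s : ℂ)‖ ≤ (1 + ξ ^ 2)⁻¹ := by
  rw [Complex.norm_cpow_real]
  have h0 : 0 < ‖1 / verticalLine ξ‖ :=
    norm_pos_iff.2 (one_div_ne_zero (verticalLine_ne_zero ξ))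
  calc ‖1 / verticalLine ξ‖ ^ s ≤ ‖1 / verticalLine ξ‖ ^ (2 : ℝ) :=
        Real.rpow_le_rpow_of_exponent_ge h0 (norm_one_div_verticalLine_le_one ξ) hs
    _ = (1 + (2 * π * ξ) ^ 2)⁻¹ := by
        rw [Real.rpow_two, norm_div, norm_one, div_pow, Complex.sq_norm, Complex.normSq_apply,
          verticalLine_re, verticalLine_im]
        ring_nf
    _ ≤ (1 + ξ ^ 2)⁻¹ := by
        have : (1 : ℝ) ≤ (2 * π) ^ 2 := one_le_pow₀ (by linarith [Real.pi_gt_three])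
        rw [mul_pow]
        exact inv_anti₀ (by positivity) (by nlinarith [sq_nonneg ξ])

theorem integrable_one_div_verticalLine_cpow {s : ℝ} (hs : 2 ≤ s) :
    Integrable fun ξ : ℝ => (1 / verticalLine ξ) ^ (s : ℂ) :=
  integrable_inv_one_add_sq.mono' (continuous_one_div_verticalLine_cpow s).aestronglyMeasurable
    (Eventually.of_forall (norm_one_div_verticalLine_cpow_le hs))

/-- Laplace's representation of the reciprocal Gamma function as an integral over the vertical
line `Re ζ = 1`. -/
theorem integral_cexp_verticalLine_mul_cpow {s : ℝ} (hs : 2 ≤ s) :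
    ∫ ξ : ℝ, Complex.exp (verticalLine ξ) * (1 / verticalLine ξ) ^ (s : ℂ) =
      (((Real.Gamma s)⁻¹ : ℝ) : ℂ) := by
  set f : ℝ → ℂ := (Ioi (0 : ℝ)).indicator
    fun t => ((t ^ (s - 1) : ℝ) : ℂ) * Complex.exp (-t) with hf
  have hfint : Integrable f := by
    rw [hf, integrable_indicator_iff measurableSet_Ioi]
    have h : IntegrableOn (fun t : ℝ => ((t ^ (s - 1) * Real.exp (-1 * t) : ℝ) : ℂ)) (Ioi 0) := by
      have := integrableOn_rpow_mul_exp_neg_mul_rpow (s := s - 1) (by linarith) one_pos one_pos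
      simp only [Real.rpow_one] at this
      exact Integrable.ofReal this
    simpa using h
  have hF : 𝓕 f = fun ξ => (1 / verticalLine ξ) ^ (s : ℂ) * (Real.Gamma s : ℂ) := by
    ext ξ
    rw [Real.fourier_real_eq_integral_exp_smul,
      ← integral_rpow_mul_cexp_neg_mul_Ioi (by linarith) (by simp [verticalLine_re]),
      ← integral_indicator measurableSet_Ioi]
    congr 1 with t
    by_cases ht : t ∈ Ioi (0 : ℝ)
    · simp only [hf, indicator_of_mem ht, smul_eq_mul]
      rw [mul_left_comm, ← Complex.exp_add]
      congr 2
      simp only [verticalLine]; push_cast; ring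
    · simp [hf, indicator_of_notMem ht]
  have hcont : ContinuousAt f 1 := by
    have h : ContinuousAt (fun t : ℝ => ((t ^ (s - 1) : ℝ) : ℂ) * Complex.exp (-t)) 1 := by
      have : ContinuousAt (fun t : ℝ => t ^ (s - 1)) 1 :=
        Real.continuousAt_rpow_const _ _ (Or.inl one_ne_zero)
      fun_prop
    refine h.congr ?_
    filter_upwards [Ioi_mem_nhds (zero_lt_one (α := ℝ))] with t ht
    simp [hf, indicator_of_mem ht]
  have hinv := hfint.fourierInv_fourier_eq
    (by rw [hF]; exact (integrable_one_div_verticalLine_cpow hs).mul_const _) hcont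
  rw [Real.fourierInv_eq', hF] at hinv
  have hG : (Real.Gamma s : ℂ) ≠ 0 := by
    exact_mod_cast (Real.Gamma_pos_of_pos (by linarith)).ne'
  have hfone : f 1 = Complex.exp (-1) := by simp [hf]
  rw [hfone] at hinv
  have key : ∫ ξ : ℝ, Complex.exp (verticalLine ξ) * (1 / verticalLine ξ) ^ (s : ℂ) =
      Complex.exp 1 * (Real.Gamma s : ℂ)⁻¹ * Complex.exp (-1) := by
    rw [← hinv, ← integral_const_mul]
    congr 1 with ξ
    have : Complex.exp (verticalLine ξ) =
        Complex.exp 1 * Complex.exp (↑(2 * π * inner ℝ ξ 1) * Complex.I) := by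
      rw [← Complex.exp_add]
      simp [verticalLine]
    rw [this, smul_eq_mul]
    field_simp
  rw [key, mul_right_comm, ← Complex.exp_add]
  simp
/-- If `v` stays in the sector `Re v ≥ a ‖v‖`, then `1 + x v` does not degenerate. -/
theorem mul_one_add_le_norm_one_add_mul {a x : ℝ} {v : ℂ} (ha : -1 ≤ a) (ha' : a ≤ 1)
    (hx : 0 ≤ x) (hv : a * ‖v‖ ≤ v.re) : (1 + a) / 2 * (1 + x * ‖v‖) ≤ ‖1 + x * v‖ := by
  refine le_of_sq_le_sq ?_ (norm_nonneg _)
  have h1 : ‖1 + x * v‖ ^ 2 = 1 + 2 * x * v.re + x ^ 2 * ‖v‖ ^ 2 := by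
    rw [Complex.sq_norm, Complex.sq_norm, Complex.normSq_apply, Complex.normSq_apply]
    simp
    ring
  have h2 : ((1 + a) / 2) ^ 2 ≤ (1 + a) / 2 := by nlinarith
  calc ((1 + a) / 2 * (1 + x * ‖v‖)) ^ 2 ≤ (1 + a) / 2 * (1 + x * ‖v‖) ^ 2 := by
        rw [mul_pow]; gcongr
    _ ≤ 1 + 2 * x * (a * ‖v‖) + x ^ 2 * ‖v‖ ^ 2 := by
        nlinarith [mul_nonneg (sub_nonneg.2 ha') (sq_nonneg (1 - x * ‖v‖))]
    _ ≤ ‖1 + x * v‖ ^ 2 := by rw [h1]; gcongr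

/-- A neighbourhood of the closed negative real axis, opening up linearly at infinity. -/
def negRealNhd (ε : ℝ) : Set ℂ := {z | ∃ x : ℝ, 0 ≤ x ∧ ‖z + x‖ < ε * (1 + x)}

theorem isOpen_negRealNhd (ε : ℝ) : IsOpen (negRealNhd ε) := by
  have : negRealNhd ε = ⋃ x : Ici (0 : ℝ), {z : ℂ | ‖z + (x : ℝ)‖ < ε * (1 + x)} := by
    ext z; simp [negRealNhd]
  rw [this]
  exact isOpen_iUnion fun x => isOpen_lt (by fun_prop) continuous_const

theorem convex_negRealNhd (ε : ℝ) : Convex ℝ (negRealNhd ε) := by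
  rintro z ⟨x, hx, hz⟩ w ⟨y, hy, hw⟩ a b ha hb hab
  refine ⟨a * x + b * y, by positivity, ?_⟩
  calc ‖a • z + b • w + ((a * x + b * y : ℝ) : ℂ)‖ = ‖(a : ℂ) * (z + x) + (b : ℂ) * (w + y)‖ := by
        congr 1
        simp only [Complex.real_smul]
        push_cast
        ring
    _ ≤ a * ‖z + x‖ + b * ‖w + y‖ := by
        refine (norm_add_le _ _).trans_eq ?_
        simp [abs_of_nonneg ha, abs_of_nonneg hb]
    _ < a * (ε * (1 + x)) + b * (ε * (1 + y)) := by
        rcases ha.eq_or_lt with rfl | ha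
        · have : b = 1 := by linarith
          subst this
          linarith
        · nlinarith [mul_lt_mul_of_pos_left hz ha, mul_le_mul_of_nonneg_left hw.le hb]
    _ = ε * (1 + (a * x + b * y)) := by linear_combination ε * hab

theorem ofReal_mem_negRealNhd {ε τ : ℝ} (hε : 0 < ε) (hτ : τ ≤ 0) : (τ : ℂ) ∈ negRealNhd ε := by
  refine ⟨-τ, by linarith, ?_⟩
  have : (0 : ℝ) < 1 + -τ := by linarith
  simpa using mul_pos hε this

theorem le_norm_one_sub_mul {a ε : ℝ} {v z : ℂ} (ha : -1 ≤ a) (ha' : a ≤ 1)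
    (hv : a * ‖v‖ ≤ v.re) (hv' : ‖v‖ ≤ 1) (hε : 0 ≤ ε) (hε' : ε ≤ (1 + a) / 2)
    (hz : z ∈ negRealNhd ε) : (1 + a) / 2 - ε ≤ ‖1 - z * v‖ := by
  obtain ⟨x, hx, hz⟩ := hz
  have h1 := mul_one_add_le_norm_one_add_mul ha ha' hx hv
  have h2 : ‖(z + x) * v‖ ≤ ε * (1 + x * ‖v‖) := by
    rw [norm_mul]
    calc ‖z + x‖ * ‖v‖ ≤ ε * (1 + x) * ‖v‖ := by gcongr
      _ = ε * (‖v‖ + x * ‖v‖) := by ring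
      _ ≤ ε * (1 + x * ‖v‖) := by gcongr
  have h3 : ‖1 + x * v‖ ≤ ‖1 - z * v‖ + ‖(z + x) * v‖ := by
    refine le_trans (le_of_eq ?_) (norm_add_le _ _)
    ring_nf
  have h4 : 0 ≤ x * ‖v‖ := by positivity
  nlinarith

/-- Differentiability of a Cauchy-type transform `z ↦ ∫ g / (1 - z v)`. -/
theorem differentiableOn_integral_div_one_sub_mul {X : Type*} [MeasurableSpace X]
    {μ : Measure X} {g v : X → ℂ} {U : Set ℂ} {m : ℝ} (hg : Integrable g μ)
    (hv : AEStronglyMeasurable v μ) (hv' : ∀ t, ‖v t‖ ≤ 1) (hU : IsOpen U) (hm : 0 < m)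
    (hUm : ∀ z ∈ U, ∀ t, m ≤ ‖1 - z * v t‖) :
    DifferentiableOn ℂ (fun z => ∫ t, g t / (1 - z * v t) ∂μ) U := by
  intro z hz
  have hmeas : ∀ w : ℂ, AEStronglyMeasurable (fun t => 1 - w * v t) μ := fun w =>
    aestronglyMeasurable_const.sub (hv.const_mul w)
  have hmeas1 : ∀ w : ℂ, AEStronglyMeasurable (fun t => g t / (1 - w * v t)) μ := fun w =>
    (hg.aestronglyMeasurable.aemeasurable.div (hmeas w).aemeasurable).aestronglyMeasurable
  refine (hasDerivAt_integral_of_dominated_loc_of_deriv_le (hU.mem_nhds hz)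
    (F' := fun w t => g t * v t / (1 - w * v t) ^ 2)
    (bound := fun t => ‖g t‖ * (m ^ 2)⁻¹)
    (Eventually.of_forall hmeas1) ?_ ?_ ?_ (hg.norm.mul_const _)
      ?_).2.differentiableAt.differentiableWithinAt
  · refine (hg.norm.mul_const m⁻¹).mono' (hmeas1 z) (Eventually.of_forall fun t => ?_)
    rw [norm_div, div_eq_mul_inv]
    gcongr
    exact hUm z hz t
  · exact ((hg.aestronglyMeasurable.mul hv).aemeasurable.div
      ((hmeas z).pow 2).aemeasurable).aestronglyMeasurable
  · refine Eventually.of_forall fun t w hw => ?_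
    rw [norm_div, div_eq_mul_inv, norm_mul, norm_pow]
    calc ‖g t‖ * ‖v t‖ * (‖1 - w * v t‖ ^ 2)⁻¹ ≤ ‖g t‖ * 1 * (m ^ 2)⁻¹ := by
          gcongr
          · exact hv' t
          · exact hUm w hw t
      _ = ‖g t‖ * (m ^ 2)⁻¹ := by ring
  · refine Eventually.of_forall fun t w hw => ?_
    have hne : 1 - w * v t ≠ 0 := norm_pos_iff.1 (hm.trans_le (hUm w hw t))
    have h1 : HasDerivAt (fun w => 1 - w * v t) (-(1 * v t)) w :=
      ((hasDerivAt_id w).mul_const (v t)).const_sub 1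
    refine ((hasDerivAt_const w (g t)).div h1 hne).congr_deriv ?_
    ring

/-- A lower bound for the Gamma function, of exponential type with arbitrary base. -/
theorem rpow_mul_exp_le_Gamma {M s : ℝ} (hM : 0 < M) (hs : 1 ≤ s) :
    M ^ (s - 1) * Real.exp (-(M + 1)) ≤ Real.Gamma s := by
  rw [Real.Gamma_eq_integral (by linarith)]
  have hint := Real.GammaIntegral_convergent (s := s) (by linarith)
  have hsub : Icc M (M + 1) ⊆ Ioi 0 := fun t ht => hM.trans_le ht.1
  calc M ^ (s - 1) * Real.exp (-(M + 1))
      = ∫ _ in Icc M (M + 1), M ^ (s - 1) * Real.exp (-(M + 1)) := by simp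
    _ ≤ ∫ t in Icc M (M + 1), Real.exp (-t) * t ^ (s - 1) := by
        refine setIntegral_mono_on (integrableOn_const (by simp)) (hint.mono_set hsub) measurableSet_Icc ?_
        intro t ht
        have hs' : 0 ≤ s - 1 := by linarith
        have := ht.1
        have := ht.2
        rw [mul_comm]
        gcongr
    _ ≤ ∫ t in Ioi 0, Real.exp (-t) * t ^ (s - 1) := by
        refine setIntegral_mono_set hint ?_ hsub.eventuallyLE
        filter_upwards [ae_restrict_mem measurableSet_Ioi] with t ht
        have ht : 0 < t := ht
        simp only [Pi.zero_apply]
        positivity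

theorem summable_pow_mul_inv_Gamma {α : ℝ} (hα : 0 < α) (β : ℝ) {R : ℝ} (hR : 0 ≤ R) :
    Summable fun k : ℕ => R ^ k * |(Real.Gamma (α * k + β))⁻¹| := by
  set M : ℝ := (2 * (R + 1)) ^ α⁻¹ with hM
  have hM0 : 0 < M := by positivity
  have hMα : M ^ α = 2 * (R + 1) := by
    rw [hM, ← Real.rpow_mul (by positivity), inv_mul_cancel₀ hα.ne', Real.rpow_one]
  refine Summable.of_norm_bounded_eventually_nat
    (g := fun k : ℕ => (M ^ (β - 1) * Real.exp (-(M + 1)))⁻¹ * (R / (2 * (R + 1))) ^ k)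
    ((summable_geometric_of_lt_one (by positivity) ?_).mul_left _) ?_
  · rw [div_lt_one (by positivity)]; linarith
  · have htend : Tendsto (fun k : ℕ => α * (k : ℝ) + β) atTop atTop :=
      tendsto_atTop_add_const_right _ _ (tendsto_natCast_atTop_atTop.const_mul_atTop hα)
    filter_upwards [htend.eventually_ge_atTop 1] with k hk
    have hΓ : 0 < Real.Gamma (α * k + β) := Real.Gamma_pos_of_pos (by linarith)
    have h := rpow_mul_exp_le_Gamma hM0 hk
    have hpow : M ^ (α * k + β - 1) = (2 * (R + 1)) ^ k * M ^ (β - 1) := by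
      rw [add_sub_assoc, Real.rpow_add hM0, Real.rpow_mul hM0.le, hMα, Real.rpow_natCast]
    rw [hpow] at h
    rw [Real.norm_of_nonneg (by positivity), abs_of_pos (inv_pos.2 hΓ)]
    calc R ^ k * (Real.Gamma (α * k + β))⁻¹
        ≤ R ^ k * ((2 * (R + 1)) ^ k * M ^ (β - 1) * Real.exp (-(M + 1)))⁻¹ := by
          gcongr
      _ = _ := by
          rw [div_pow]
          field_simp

/-- The Mittag-Leffler function of a complex argument. -/
noncomputable def mittagLeffler (α β : ℝ) (z : ℂ) : ℂ :=
  ∑' k : ℕ, z ^ k * (((Real.Gamma (α * k + β))⁻¹ : ℝ) : ℂ)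

theorem norm_mittagLeffler_term (α β : ℝ) (z : ℂ) (k : ℕ) :
    ‖z ^ k * (((Real.Gamma (α * k + β))⁻¹ : ℝ) : ℂ)‖ =
      ‖z‖ ^ k * |(Real.Gamma (α * k + β))⁻¹| := by
  rw [norm_mul, norm_pow, Complex.norm_real, Real.norm_eq_abs]

theorem summable_mittagLeffler {α : ℝ} (hα : 0 < α) (β : ℝ) (z : ℂ) :
    Summable fun k : ℕ => z ^ k * (((Real.Gamma (α * k + β))⁻¹ : ℝ) : ℂ) := by
  refine Summable.of_norm ?_
  simp only [norm_mittagLeffler_term]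
  exact summable_pow_mul_inv_Gamma hα β (norm_nonneg z)

theorem mittagLeffler_term_le (α β : ℝ) {R : ℝ} (k : ℕ) {w : ℂ} (hw : w ∈ Metric.ball 0 R) :
    ‖w ^ k * (((Real.Gamma (α * k + β))⁻¹ : ℝ) : ℂ)‖ ≤
      R ^ k * |(Real.Gamma (α * k + β))⁻¹| := by
  rw [norm_mittagLeffler_term]
  have : ‖w‖ ≤ R := (mem_ball_zero_iff.1 hw).le
  gcongr

theorem differentiable_mittagLeffler {α : ℝ} (hα : 0 < α) (β : ℝ) :
    Differentiable ℂ (mittagLeffler α β) := by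
  intro z
  have hz : z ∈ Metric.ball (0 : ℂ) (‖z‖ + 1) := by simp
  exact (Complex.differentiableOn_tsum_of_summable_norm
    (summable_pow_mul_inv_Gamma hα β (R := ‖z‖ + 1) (by positivity))
    (fun k => by fun_prop) Metric.isOpen_ball
    (fun k w hw => mittagLeffler_term_le α β k hw)).differentiableAt
      (Metric.isOpen_ball.mem_nhds hz)

theorem mul_inv_Gamma (s : ℝ) : (s - 1) * (Real.Gamma s)⁻¹ = (Real.Gamma (s - 1))⁻¹ := by
  rcases eq_or_ne (s - 1) 0 with h | h
  · simp [h]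
  · have h2 := Real.Gamma_add_one h
    rw [sub_add_cancel] at h2
    rw [h2]
    field_simp

/-- Lowering the second parameter by one is a first order differential operator. -/
theorem mittagLeffler_sub_one {α : ℝ} (hα : 0 < α) (β : ℝ) (z : ℂ) :
    mittagLeffler α (β - 1) z =
      α * z * deriv (mittagLeffler α β) z + (β - 1) * mittagLeffler α β z := by
  have hz : z ∈ Metric.ball (0 : ℂ) (‖z‖ + 1) := by simp
  have h1 := Complex.hasSum_deriv_of_summable_norm
    (F := fun (k : ℕ) (w : ℂ) => w ^ k * (((Real.Gamma (α * k + β))⁻¹ : ℝ) : ℂ))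
    (summable_pow_mul_inv_Gamma hα β (R := ‖z‖ + 1) (by positivity))
    (fun k => by fun_prop) Metric.isOpen_ball
    (fun k w hw => mittagLeffler_term_le α β k hw) hz
  have h2 := (h1.mul_left (α * z)).add ((summable_mittagLeffler hα β z).hasSum.mul_left (β - 1 : ℂ))
  refine Eq.trans ?_ h2.tsum_eq
  unfold mittagLeffler
  congr 1 with k
  have h3 : α * k + (β - 1) = (α * k + β) - 1 := by ring
  rw [h3, ← mul_inv_Gamma, deriv_mul_const (by fun_prop), deriv_pow_field]
  rcases k with _ | k
  · push_cast; simp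
  · push_cast
    ring

theorem mittagLeffler_eq_add_mul {α : ℝ} (hα : 0 < α) (β : ℝ) (z : ℂ) :
    mittagLeffler α β z =
      (((Real.Gamma β)⁻¹ : ℝ) : ℂ) + z * mittagLeffler α (β + α) z := by
  unfold mittagLeffler
  rw [(summable_mittagLeffler hα β z).tsum_eq_zero_add, ← tsum_mul_left]
  congr 1
  · simp
  · congr 1 with k
    rw [pow_succ']
    push_cast
    ring_nf

theorem cos_mul_norm_le_cpow_re {α : ℝ} (hα : α ∈ Ioo (0 : ℝ) 2) {w : ℂ} (hw : 0 < w.re) :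
    Real.cos (α * (π / 2)) * ‖w ^ (α : ℂ)‖ ≤ (w ^ (α : ℂ)).re := by
  obtain ⟨h0, h2⟩ := hα
  rw [Complex.norm_cpow_real, Complex.cpow_ofReal_re, mul_comm]
  refine mul_le_mul_of_nonneg_left ?_ (by positivity)
  rw [← Real.cos_abs (w.arg * α), abs_mul, abs_of_pos h0]
  have harg : |w.arg| ≤ π / 2 := Complex.abs_arg_le_pi_div_two_iff.2 hw.le
  refine Real.cos_le_cos_of_nonneg_of_le_pi (by positivity) (by nlinarith [Real.pi_pos]) ?_
  rw [mul_comm]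
  gcongr

/-- The integrand of the contour representation of the Mittag-Leffler function, at `z = 0`. -/
theorem integrable_cexp_verticalLine_mul_cpow {s : ℝ} (hs : 2 ≤ s) :
    Integrable fun ξ : ℝ => Complex.exp (verticalLine ξ) * (1 / verticalLine ξ) ^ (s : ℂ) := by
  refine (integrable_one_div_verticalLine_cpow hs).bdd_mul (c := Real.exp 1)
    continuous_verticalLine.cexp.aestronglyMeasurable (Eventually.of_forall fun ξ => ?_)
  rw [Complex.norm_exp, verticalLine_re]

theorem norm_one_div_verticalLine_cpow_le_one {α : ℝ} (hα : 0 < α) (ξ : ℝ) :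
    ‖(1 / verticalLine ξ) ^ (α : ℂ)‖ ≤ 1 := by
  rw [Complex.norm_cpow_real]
  exact Real.rpow_le_one (norm_nonneg _) (norm_one_div_verticalLine_le_one ξ) hα.le

theorem mittagLeffler_eq_integral_of_norm_lt_one {α β : ℝ} (hα : 0 < α) (hβ : 2 ≤ β) {z : ℂ}
    (hz : ‖z‖ < 1) :
    mittagLeffler α β z = ∫ ξ : ℝ, Complex.exp (verticalLine ξ) * (1 / verticalLine ξ) ^ (β : ℂ) /
      (1 - z * (1 / verticalLine ξ) ^ (α : ℂ)) := by
  set g : ℝ → ℂ := fun ξ => Complex.exp (verticalLine ξ) * (1 / verticalLine ξ) ^ (β : ℂ) with hg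
  set v : ℝ → ℂ := fun ξ => (1 / verticalLine ξ) ^ (α : ℂ) with hv
  have hgint : Integrable g := integrable_cexp_verticalLine_mul_cpow hβ
  have hv1 : ∀ ξ, ‖v ξ‖ ≤ 1 := norm_one_div_verticalLine_cpow_le_one hα
  have hvc : Continuous v := continuous_one_div_verticalLine_cpow α
  have hzv : ∀ ξ, ‖z * v ξ‖ ≤ ‖z‖ := fun ξ => by
    rw [norm_mul]
    exact mul_le_of_le_one_right (norm_nonneg _) (hv1 ξ)
  have hle : ∀ (k : ℕ) ξ, ‖g ξ * (z * v ξ) ^ k‖ ≤ ‖g ξ‖ * ‖z‖ ^ k := by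
    intro k ξ
    rw [norm_mul, norm_pow]
    gcongr
    exact hzv ξ
  have hFint : ∀ k : ℕ, Integrable fun ξ => g ξ * (z * v ξ) ^ k := fun k =>
    (hgint.norm.mul_const (‖z‖ ^ k)).mono' (hgint.aestronglyMeasurable.mul
      (by fun_prop : Continuous fun ξ => (z * v ξ) ^ k).aestronglyMeasurable)
      (Eventually.of_forall (hle k))
  have hsum := hasSum_integral_of_summable_integral_norm hFint <| by
    refine Summable.of_nonneg_of_le (fun k => by positivity) (fun k => ?_)
      ((summable_geometric_of_lt_one (norm_nonneg z) hz).mul_left (∫ ξ, ‖g ξ‖))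
    rw [← integral_mul_const]
    exact integral_mono (hFint k).norm (hgint.norm.mul_const _) (hle k)
  have hterm : ∀ k : ℕ, ∫ ξ, g ξ * (z * v ξ) ^ k =
      z ^ k * (((Real.Gamma (α * k + β))⁻¹ : ℝ) : ℂ) := by
    intro k
    have hs : 2 ≤ α * k + β := by
      have : 0 ≤ α * k := by positivity
      linarith
    rw [← integral_cexp_verticalLine_mul_cpow hs, ← integral_const_mul]
    congr 1 with ξ
    have hne : 1 / verticalLine ξ ≠ 0 := one_div_ne_zero (verticalLine_ne_zero ξ)
    have : (1 / verticalLine ξ) ^ ((α * k + β : ℝ) : ℂ) =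
        v ξ ^ k * (1 / verticalLine ξ) ^ (β : ℂ) := by
      push_cast
      rw [Complex.cpow_add _ _ hne, mul_comm (α : ℂ), Complex.cpow_nat_mul]
    rw [this, mul_pow]
    simp only [hg]
    ring
  simp only [hterm] at hsum
  rw [mittagLeffler, hsum.tsum_eq]
  congr 1 with ξ
  rw [tsum_mul_left, tsum_geometric_of_norm_lt_one ((hzv ξ).trans_lt hz), div_eq_mul_inv]

theorem exists_norm_mittagLeffler_le_of_two_le {α β : ℝ} (hα : α ∈ Ioo (0 : ℝ) 2) (hβ : 2 ≤ β) :
    ∃ ε > 0, ∃ C, ∀ z ∈ negRealNhd ε, ‖mittagLeffler α β z‖ ≤ C := by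
  set a : ℝ := Real.cos (α * (π / 2)) with ha
  have ha1 : -1 < a := by
    rw [ha, ← Real.cos_pi]
    exact Real.cos_lt_cos_of_nonneg_of_le_pi (by have := hα.1; positivity) le_rfl
      (by nlinarith [Real.pi_pos, hα.2])
  have ha2 : a ≤ 1 := Real.cos_le_one _
  set ε : ℝ := (1 + a) / 4 with hε
  have hε0 : 0 < ε := by linarith
  have hU : ∀ z ∈ negRealNhd ε, ∀ ξ, ε ≤ ‖1 - z * (1 / verticalLine ξ) ^ (α : ℂ)‖ := by
    intro z hz ξ
    refine le_trans (by linarith) (le_norm_one_sub_mul ha1.le ha2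
      (cos_mul_norm_le_cpow_re hα (one_div_verticalLine_re_pos ξ))
      (norm_one_div_verticalLine_cpow_le_one hα.1 ξ) hε0.le (by linarith) hz)
  have hg := integrable_cexp_verticalLine_mul_cpow hβ
  have hdiff := differentiableOn_integral_div_one_sub_mul hg
    (continuous_one_div_verticalLine_cpow α).aestronglyMeasurable
    (norm_one_div_verticalLine_cpow_le_one hα.1) (isOpen_negRealNhd ε) hε0 hU
  have heq := ((differentiable_mittagLeffler hα.1 β).differentiableOn.analyticOnNhd
    (isOpen_negRealNhd ε)).eqOn_of_preconnected_of_eventuallyEq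
    (hdiff.analyticOnNhd (isOpen_negRealNhd ε)) (convex_negRealNhd ε).isPreconnected
    (z₀ := 0) (by simpa using ofReal_mem_negRealNhd hε0 le_rfl) (by
      filter_upwards [Metric.ball_mem_nhds (0 : ℂ) one_pos] with z hz
      exact mittagLeffler_eq_integral_of_norm_lt_one hα.1 hβ (mem_ball_zero_iff.1 hz))
  refine ⟨ε, hε0, ∫ ξ : ℝ, ‖Complex.exp (verticalLine ξ) * (1 / verticalLine ξ) ^ (β : ℂ)‖ * ε⁻¹,
    fun z hz => ?_⟩
  rw [heq hz]
  refine norm_integral_le_of_norm_le (hg.norm.mul_const ε⁻¹) (Eventually.of_forall fun ξ => ?_)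
  rw [norm_div, div_eq_mul_inv]
  gcongr
  exact hU z hz ξ

theorem exists_norm_mittagLeffler_sub_one_le {α β : ℝ} (hα : 0 < α)
    (h : ∃ ε > 0, ∃ C, ∀ z ∈ negRealNhd ε, ‖mittagLeffler α β z‖ ≤ C) :
    ∃ ε > 0, ∃ C, ∀ z ∈ negRealNhd ε, ‖mittagLeffler α (β - 1) z‖ ≤ C := by
  obtain ⟨ε, hε, C, hC⟩ := h
  refine ⟨ε / 2, by positivity, α * ((1 + ε) * (C / (ε / 2))) + |β - 1| * C, ?_⟩
  rintro z ⟨x, hx, hz⟩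
  have hC0 : 0 ≤ C := (norm_nonneg _).trans (hC _ (ofReal_mem_negRealNhd hε le_rfl))
  have hx1 : 0 < 1 + x := by linarith
  have hzC : ‖mittagLeffler α β z‖ ≤ C := hC z ⟨x, hx, hz.trans (by gcongr; linarith)⟩
  have hderiv : ‖deriv (mittagLeffler α β) z‖ ≤ C / (ε / 2 * (1 + x)) := by
    refine Complex.norm_deriv_le_of_forall_mem_sphere_norm_le (by positivity)
      (differentiable_mittagLeffler hα β).diffContOnCl fun w hw => hC w ⟨x, hx, ?_⟩
    rw [mem_sphere_iff_norm] at hw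
    calc ‖w + x‖ = ‖(w - z) + (z + x)‖ := by ring_nf
      _ ≤ ‖w - z‖ + ‖z + x‖ := norm_add_le _ _
      _ < ε / 2 * (1 + x) + ε / 2 * (1 + x) := by rw [hw]; gcongr
      _ = ε * (1 + x) := by ring
  have hznorm : ‖z‖ ≤ (1 + ε) * (1 + x) := by
    calc ‖z‖ = ‖(z + x) - x‖ := by ring_nf
      _ ≤ ‖z + x‖ + ‖(x : ℂ)‖ := norm_sub_le _ _
      _ ≤ ε / 2 * (1 + x) + x := by
        rw [Complex.norm_real, Real.norm_of_nonneg hx]; gcongr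
      _ ≤ (1 + ε) * (1 + x) := by nlinarith
  have hβn : ‖(β - 1 : ℂ)‖ = |β - 1| := by
    rw [← Real.norm_eq_abs, ← Complex.norm_real]; push_cast; rfl
  rw [mittagLeffler_sub_one hα]
  refine (norm_add_le _ _).trans ?_
  rw [norm_mul, norm_mul, norm_mul, hβn, Complex.norm_real, Real.norm_of_nonneg hα.le, mul_assoc]
  refine add_le_add (mul_le_mul_of_nonneg_left ?_ hα.le) (by gcongr)
  calc ‖z‖ * ‖deriv (mittagLeffler α β) z‖
      ≤ (1 + ε) * (1 + x) * (C / (ε / 2 * (1 + x))) := by gcongr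
    _ = (1 + ε) * (C / (ε / 2)) := by field_simp

/-- For `0 < α < 2`, the Mittag-Leffler function is bounded near the negative real axis. -/
theorem exists_norm_mittagLeffler_le {α : ℝ} (hα : α ∈ Ioo (0 : ℝ) 2) (β : ℝ) :
    ∃ ε > 0, ∃ C, ∀ z ∈ negRealNhd ε, ‖mittagLeffler α β z‖ ≤ C := by
  have hstep : ∀ (n : ℕ) (β : ℝ), 2 ≤ β + n →
      ∃ ε > 0, ∃ C, ∀ z ∈ negRealNhd ε, ‖mittagLeffler α β z‖ ≤ C := by
    intro n
    induction n with
    | zero => intro β hβ; exact exists_norm_mittagLeffler_le_of_two_le hα (by simpa using hβ)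
    | succ n ih =>
      intro β hβ
      have := exists_norm_mittagLeffler_sub_one_le hα.1
        (ih (β + 1) (by push_cast at hβ; linarith))
      rwa [add_sub_cancel_right] at this
  obtain ⟨n, hn⟩ := exists_nat_ge (2 - β)
  exact hstep n β (by linarith)

/-- Uniform bound on the Mittag-Leffler function `E_{β₁,β₂}` on `(-∞, 0]`:
there is `c > 0` with `|E_{β₁,β₂}(τ)| ≤ c / (1 + |τ|)` for all `τ ≤ 0`. -/
theorem stmt7 (β₁ β₂ : ℝ) (hβ₁ : β₁ ∈ Set.Ioo (0 : ℝ) 2)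
    (E : ℝ → ℝ) (hE : ∀ x : ℝ, E x = ∑' k : ℕ, x ^ k * (Real.Gamma (β₁ * k + β₂))⁻¹) :
    ∃ c > 0, ∀ τ : ℝ, τ ≤ 0 → |E τ| ≤ c / (1 + |τ|) := by
  obtain ⟨ε, hε, C, hC⟩ := exists_norm_mittagLeffler_le hβ₁ β₂
  obtain ⟨δ, hδ, D, hD⟩ := exists_norm_mittagLeffler_le hβ₁ (β₂ - β₁)
  have hC0 : 0 ≤ C := (norm_nonneg _).trans (hC _ (ofReal_mem_negRealNhd hε le_rfl))
  have hD0 : 0 ≤ D := (norm_nonneg _).trans (hD _ (ofReal_mem_negRealNhd hδ le_rfl))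
  refine ⟨C + D + |(Real.Gamma (β₂ - β₁))⁻¹| + 1, by positivity, fun τ hτ => ?_⟩
  have hEτ : (E τ : ℂ) = mittagLeffler β₁ β₂ τ := by
    rw [hE, Complex.ofReal_tsum, mittagLeffler]
    push_cast
    rfl
  have hnorm : |E τ| = ‖mittagLeffler β₁ β₂ τ‖ := by
    rw [← hEτ, Complex.norm_real, Real.norm_eq_abs]
  have h1 : |E τ| ≤ C := hnorm ▸ hC _ (ofReal_mem_negRealNhd hε hτ)
  have h2 : |τ| * |E τ| ≤ D + |(Real.Gamma (β₂ - β₁))⁻¹| := by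
    have h := mittagLeffler_eq_add_mul hβ₁.1 (β₂ - β₁) τ
    rw [sub_add_cancel] at h
    calc |τ| * |E τ| = ‖(τ : ℂ) * mittagLeffler β₁ β₂ τ‖ := by
          rw [norm_mul, hnorm, Complex.norm_real, Real.norm_eq_abs]
      _ = ‖mittagLeffler β₁ (β₂ - β₁) τ - (((Real.Gamma (β₂ - β₁))⁻¹ : ℝ) : ℂ)‖ := by
          rw [h, add_sub_cancel_left]
      _ ≤ D + |(Real.Gamma (β₂ - β₁))⁻¹| := by
          refine (norm_sub_le _ _).trans ?_
          rw [Complex.norm_real, Real.norm_eq_abs]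
          gcongr
          exact hD _ (ofReal_mem_negRealNhd hδ hτ)
  rw [le_div_iff₀ (by positivity)]
  linarith
end

section
/- Let β₁ ∈ (0,2), β₂ ∈ ℝ and N ∈ ℕ, N ≥ 1, and define the Mittag-Leffler function E_{β₁,β₂}(x) := ∑_{k=0}^∞ x^k · (Γ(β₁ k + β₂))⁻¹ for x ∈ ℝ. Then the function τ ↦ E_{β₁,β₂}(τ) + ∑_{k=1}^N τ^{-k} · (Γ(β₂ - β₁ k))⁻¹ is O(|τ|^{-(N+1)}) as τ → -∞. -/
open Real Filter Asymptotics

theorem norm_mul_le_norm_mul_of_le {u v y : ℝ} (hv : 0 ≤ v) (huv : v ≤ u) :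
    ‖(u + y * Complex.I : ℂ)‖ * ‖(v : ℂ)‖ ≤ ‖(v + y * Complex.I : ℂ)‖ * ‖(u : ℂ)‖ := by
  rw [← norm_mul, ← norm_mul, ← sq_le_sq₀ (norm_nonneg _) (norm_nonneg _), Complex.sq_norm,
    Complex.sq_norm, Complex.normSq_apply, Complex.normSq_apply]
  simp only [Complex.mul_re, Complex.mul_im, Complex.add_re, Complex.add_im, Complex.ofReal_re,
    Complex.ofReal_im, Complex.I_re, Complex.I_im]
  nlinarith [mul_nonneg (sq_nonneg y) (sub_nonneg.2 (pow_le_pow_left₀ hv huv 2))]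

/-- The quotient `|Γ(x + iy)| / Γ(x)` is monotone in `x > 0`. -/
theorem norm_Gamma_mul_le {a x : ℝ} (y : ℝ) (ha : 0 < a) (hax : a ≤ x) :
    ‖Complex.Gamma (a + y * Complex.I)‖ * ‖Complex.Gamma x‖ ≤
      ‖Complex.Gamma (x + y * Complex.I)‖ * ‖Complex.Gamma a‖ := by
  have lim := fun s => (Complex.GammaSeq_tendsto_Gamma s).norm
  refine le_of_tendsto_of_tendsto ((lim _).mul (lim _)) ((lim _).mul (lim _)) ?_
  filter_upwards [eventually_gt_atTop 0] with n hn
  have hn' : (0 : ℝ) < n := by exact_mod_cast hn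
  have hcpow : ∀ s : ℂ, ‖(n : ℂ) ^ s‖ = (n : ℝ) ^ s.re := fun s => by
    exact_mod_cast Complex.norm_cpow_eq_rpow_re_of_pos hn' s
  have hprod : (∏ j ∈ Finset.range (n + 1), ‖(x + y * Complex.I + j : ℂ)‖) *
      (∏ j ∈ Finset.range (n + 1), ‖(a + j : ℂ)‖) ≤
      (∏ j ∈ Finset.range (n + 1), ‖(a + y * Complex.I + j : ℂ)‖) *
      (∏ j ∈ Finset.range (n + 1), ‖(x + j : ℂ)‖) := by
    rw [← Finset.prod_mul_distrib, ← Finset.prod_mul_distrib]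
    refine Finset.prod_le_prod (fun _ _ => by positivity) fun j _ => ?_
    have := norm_mul_le_norm_mul_of_le (u := x + j) (v := a + j) (y := y) (by positivity)
      (by linarith)
    push_cast at this
    rwa [add_right_comm (x : ℂ), add_right_comm (a : ℂ)] at this
  have hpos : ∀ b t : ℝ, 0 < b →
      0 < ∏ j ∈ Finset.range (n + 1), ‖(b + t * Complex.I + j : ℂ)‖ := fun b t hb =>
    Finset.prod_pos fun j _ => norm_pos_iff.2 fun h => by
      have h0 := congrArg Complex.re h
      have : (0 : ℝ) < b + j := by positivity
      simp at h0
      linarith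
  have hpos' : ∀ b : ℝ, 0 < b → 0 < ∏ j ∈ Finset.range (n + 1), ‖(b + j : ℂ)‖ :=
    fun b hb => by simpa using hpos b 0 hb
  have hx := ha.trans_le hax
  simp only [Complex.GammaSeq, norm_div, norm_mul, norm_prod, hcpow, Complex.add_re,
    Complex.mul_re, Complex.ofReal_re, Complex.ofReal_im, Complex.I_re, Complex.I_im, mul_zero,
    zero_mul, sub_zero, add_zero]
  rw [div_mul_div_comm, div_mul_div_comm,
    div_le_div_iff₀ (mul_pos (hpos _ _ ha) (hpos' _ hx)) (mul_pos (hpos _ _ hx) (hpos' _ ha))]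
  calc _ ≤ ((n : ℝ) ^ a * ‖(n.factorial : ℂ)‖ * ((n : ℝ) ^ x * ‖(n.factorial : ℂ)‖)) * _ :=
        mul_le_mul_of_nonneg_left hprod (by positivity)
    _ = _ := by ring

theorem exp_neg_le_norm_sq_Gamma_half (y : ℝ) :
    π * exp (-(π * |y|)) ≤ ‖Complex.Gamma ((1 / 2 : ℝ) + y * Complex.I)‖ ^ 2 := by
  set z : ℂ := (1 / 2 : ℝ) + y * Complex.I with hz
  have hconj : 1 - z = (starRingEnd ℂ) z := by
    apply Complex.ext <;> simp [hz]
    norm_num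
  have h := Complex.Gamma_mul_Gamma_one_sub z
  rw [hconj, Complex.Gamma_conj, Complex.mul_conj] at h
  have hsin : Complex.sin (π * z) = (cosh (π * y) : ℝ) := by
    have : (π * z : ℂ) = (π * y : ℝ) * Complex.I + π / 2 := by
      rw [hz]; push_cast; ring
    rw [this, Complex.sin_add_pi_div_two, Complex.cos_mul_I, Complex.ofReal_cosh]
  rw [hsin, ← Complex.ofReal_div] at h
  rw [Complex.sq_norm, Complex.ofReal_injective h, exp_neg, ← div_eq_mul_inv]
  refine div_le_div_of_nonneg_left pi_pos.le (cosh_pos _) ?_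
  rw [← cosh_abs, abs_mul, abs_of_pos pi_pos, cosh_eq]
  have : exp (-(π * |y|)) ≤ exp (π * |y|) := exp_le_exp.2 (by
    have : 0 ≤ π * |y| := by positivity
    linarith)
  linarith

theorem norm_inv_Gamma_le {z : ℂ} (hz : 1 / 2 ≤ z.re) :
    ‖(Complex.Gamma z)⁻¹‖ ≤ exp (π / 2 * |z.im|) * (Gamma z.re)⁻¹ := by
  have hG := Gamma_pos_of_pos (show 0 < z.re by linarith)
  have h := norm_Gamma_mul_le z.im (by norm_num : (0 : ℝ) < 1 / 2) hz
  rw [Complex.re_add_im, Complex.Gamma_ofReal, Complex.Gamma_ofReal, Gamma_one_half_eq,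
    Complex.norm_of_nonneg hG.le, Complex.norm_of_nonneg (sqrt_nonneg _)] at h
  have h2 : √π * exp (-(π / 2 * |z.im|)) ≤
      ‖Complex.Gamma ((1 / 2 : ℝ) + z.im * Complex.I)‖ := by
    rw [← sq_le_sq₀ (by positivity) (norm_nonneg _), mul_pow, sq_sqrt pi_pos.le, ← exp_nat_mul]
    refine le_trans (le_of_eq ?_) (exp_neg_le_norm_sq_Gamma_half z.im)
    congr 2
    push_cast
    ring
  have h3 : exp (-(π / 2 * |z.im|)) * Gamma z.re ≤ ‖Complex.Gamma z‖ := by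
    have := (mul_le_mul_of_nonneg_right h2 hG.le).trans h
    have hp := sqrt_pos.2 pi_pos
    nlinarith
  rw [norm_inv, ← inv_inv (exp _), ← exp_neg, ← mul_inv]
  exact inv_anti₀ (by positivity) h3

theorem rpow_mul_inv_Gamma_le {R x : ℝ} (hR : 1 ≤ R) (hx : 2 ≤ x) :
    R ^ x * (Gamma x)⁻¹ ≤ R ^ 2 * exp R := by
  obtain ⟨m, hm⟩ : ∃ m : ℕ, ⌊x⌋₊ = m + 1 :=
    Nat.exists_eq_succ_of_ne_zero (by have := Nat.le_floor (n := 2) (a := x) hx; omega)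
  have h1 : (m : ℝ) + 1 ≤ x := by
    have := Nat.floor_le (show 0 ≤ x by linarith)
    rw [hm] at this
    exact_mod_cast this
  have h2 : x ≤ m + 2 := by
    have := (Nat.lt_floor_add_one x).le
    rw [hm] at this
    push_cast at this
    linarith
  have h3 : (1 : ℝ) ≤ m := by
    have := Nat.le_floor (n := 2) (a := x) hx
    have : 1 ≤ m := by omega
    exact_mod_cast this
  have hG : (m.factorial : ℝ) ≤ Gamma x := by
    rw [← Gamma_nat_eq_factorial]
    exact Gamma_strictMonoOn_Ici.monotoneOn (show (2 : ℝ) ≤ m + 1 by linarith) hx h1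
  have hf : (0 : ℝ) < m.factorial := by positivity
  calc R ^ x * (Gamma x)⁻¹ ≤ R ^ ((m + 2 : ℕ) : ℝ) * (m.factorial : ℝ)⁻¹ := by
        gcongr
        push_cast
        linarith
    _ = R ^ 2 * (R ^ m / m.factorial) := by rw [rpow_natCast]; ring
    _ ≤ _ := by gcongr; exact pow_div_factorial_le_exp _ (zero_le_one.trans hR) _

theorem add_mul_exp_le {A d κ t : ℝ} (hA : 0 ≤ A) (hd : 0 < d) (ht : 0 ≤ t) :
    (A + t) * exp (κ * t) ≤ (A + d⁻¹) * exp ((κ + d) * t) := by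
  rw [add_mul κ, exp_add, mul_comm (exp (κ * t)), ← mul_assoc]
  refine mul_le_mul_of_nonneg_right ?_ (exp_pos _).le
  have h1 := add_one_le_exp (d * t)
  have h2 : 0 ≤ d * t := by positivity
  have h3 : t = d⁻¹ * (d * t) := by field_simp
  have h4 : 0 ≤ d⁻¹ := by positivity
  nlinarith

theorem exists_rpow_mul_norm_inv_Gamma_le {R κ : ℝ} (hR : 1 ≤ R) (hκ : π / 2 < κ) (c : ℝ) :
    ∃ C : ℝ, 0 ≤ C ∧ ∀ z : ℂ, c ≤ z.re →
      R ^ z.re * ‖(Complex.Gamma z)⁻¹‖ ≤ C * exp (κ * |z.im|) := by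
  suffices H : ∀ n : ℕ, ∀ κ > π / 2, ∃ C : ℝ, 0 ≤ C ∧ ∀ z : ℂ, 2 - (n : ℝ) ≤ z.re →
      R ^ z.re * ‖(Complex.Gamma z)⁻¹‖ ≤ C * exp (κ * |z.im|) by
    obtain ⟨n, hn⟩ := exists_nat_ge (2 - c)
    obtain ⟨C, hC, h⟩ := H n κ hκ
    exact ⟨C, hC, fun z hz => h z (by linarith)⟩
  have hR0 : 0 < R := by linarith
  intro n
  induction n with
  | zero =>
    intro κ hκ
    refine ⟨R ^ 2 * exp R, by positivity, fun z hz => ?_⟩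
    have hexp : exp (π / 2 * |z.im|) ≤ exp (κ * |z.im|) := by gcongr
    have hz2 : 2 ≤ z.re := by simpa using hz
    calc R ^ z.re * ‖(Complex.Gamma z)⁻¹‖
        ≤ R ^ z.re * (exp (π / 2 * |z.im|) * (Gamma z.re)⁻¹) := by
          gcongr
          exact norm_inv_Gamma_le (by linarith)
      _ = R ^ z.re * (Gamma z.re)⁻¹ * exp (π / 2 * |z.im|) := by ring
      _ ≤ _ := by
          exact mul_le_mul (rpow_mul_inv_Gamma_le hR hz2) hexp (exp_pos _).le (by positivity)
  | succ n ih =>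
    intro κ hκ
    obtain ⟨κ', hκ', hκκ'⟩ := exists_between hκ
    obtain ⟨C, hC, h⟩ := ih κ' hκ'
    set A : ℝ := |2 - (n : ℝ)| + 1 with hA
    have hA0 : 1 ≤ A := by linarith [abs_nonneg (2 - (n : ℝ))]
    have hd : 0 < κ - κ' := by linarith
    refine ⟨C + C * (A + (κ - κ')⁻¹), by positivity, fun z hz => ?_⟩
    rw [add_mul]
    have hpos : 0 ≤ C * (A + (κ - κ')⁻¹) := by positivity
    rcases le_or_gt (2 - (n : ℝ)) z.re with hzn | hzn
    · calc _ ≤ C * exp (κ' * |z.im|) := h z hzn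
        _ ≤ C * exp (κ * |z.im|) := by gcongr
        _ ≤ _ := le_add_of_nonneg_right (by positivity)
    · push_cast at hz
      have hn := h (z + 1) (by simp; linarith)
      have hzA : ‖z‖ ≤ A + |z.im| := by
        refine (Complex.norm_le_abs_re_add_abs_im z).trans ?_
        gcongr
        rw [hA, abs_le]
        constructor <;> linarith [neg_abs_le (2 - (n : ℝ)), le_abs_self (2 - (n : ℝ))]
      rw [Complex.one_div_Gamma_eq_self_mul_one_div_Gamma_add_one, norm_mul]
      simp only [Complex.add_re, Complex.one_re, Complex.add_im, Complex.one_im, add_zero] at hn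
      calc R ^ z.re * (‖z‖ * ‖(Complex.Gamma (z + 1))⁻¹‖)
          = ‖z‖ * (R ^ z.re * ‖(Complex.Gamma (z + 1))⁻¹‖) := by ring
        _ ≤ (A + |z.im|) * (R ^ (z.re + 1) * ‖(Complex.Gamma (z + 1))⁻¹‖) := by
            gcongr
            linarith
        _ ≤ (A + |z.im|) * (C * exp (κ' * |z.im|)) := by gcongr
        _ = C * ((A + |z.im|) * exp (κ' * |z.im|)) := by ring
        _ ≤ C * ((A + (κ - κ')⁻¹) * exp ((κ' + (κ - κ')) * |z.im|)) := by
            exact mul_le_mul_of_nonneg_left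
              (add_mul_exp_le (zero_le_one.trans hA0) hd (abs_nonneg _)) hC
        _ = C * (A + (κ - κ')⁻¹) * exp (κ * |z.im|) := by rw [add_sub_cancel]; ring
        _ ≤ _ := le_add_of_nonneg_left (by positivity)

theorem exp_le_two_mul_cosh (t : ℝ) : exp (π * |t|) ≤ 2 * cosh (π * t) := by
  rw [← cosh_abs, abs_mul, abs_of_pos pi_pos, cosh_eq]
  linarith [exp_pos (-(π * |t|))]

theorem integrable_exp_neg_mul_abs {η : ℝ} (hη : 0 < η) :
    MeasureTheory.Integrable fun t : ℝ => exp (-(η * |t|)) := by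
  rw [← MeasureTheory.integrableOn_univ, ← Set.Iic_union_Ioi (a := (0 : ℝ))]
  refine MeasureTheory.IntegrableOn.union ?_ ?_
  · refine (integrableOn_exp_mul_Iic hη 0).congr_fun (fun t ht => ?_) measurableSet_Iic
    simp [abs_of_nonpos (Set.mem_Iic.1 ht)]
  · refine (integrableOn_exp_mul_Ioi (neg_neg_of_pos hη) 0).congr_fun (fun t ht => ?_)
      measurableSet_Ioi
    simp [abs_of_pos (Set.mem_Ioi.1 ht)]

theorem exp_mul_inv_cosh_le {κ : ℝ} (t : ℝ) :
    exp (κ * |t|) * (cosh (π * t))⁻¹ ≤ 2 * exp (-((π - κ) * |t|)) := by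
  rw [← div_eq_mul_inv, div_le_iff₀ (cosh_pos _)]
  have : exp (κ * |t|) = exp (-((π - κ) * |t|)) * exp (π * |t|) := by
    rw [← exp_add]; ring_nf
  rw [this]
  nlinarith [exp_le_two_mul_cosh t, exp_pos (-((π - κ) * |t|))]

theorem integrable_exp_mul_inv_cosh {κ : ℝ} (hκ : κ < π) :
    MeasureTheory.Integrable fun t : ℝ => exp (κ * |t|) * (cosh (π * t))⁻¹ := by
  refine ((integrable_exp_neg_mul_abs (sub_pos.2 hκ)).const_mul 2).mono' ?_ ?_
  · refine Continuous.aestronglyMeasurable ?_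
    have : ∀ t : ℝ, cosh (π * t) ≠ 0 := fun t => (cosh_pos _).ne'
    fun_prop (disch := assumption)
  · refine Eventually.of_forall fun t => ?_
    have := cosh_pos (π * t)
    rw [norm_of_nonneg (by positivity)]
    exact exp_mul_inv_cosh_le t

theorem integral_inv_cosh : ∫ t : ℝ, (cosh (π * t))⁻¹ = 1 := by
  have hi : MeasureTheory.Integrable fun t : ℝ => (cosh (π * t))⁻¹ := by
    simpa using integrable_exp_mul_inv_cosh pi_pos
  have htop : Tendsto (fun t : ℝ => sinh (π * t)) atTop atTop := by
    refine tendsto_atTop_mono' _ ?_ (tendsto_id.const_mul_atTop pi_pos)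
    filter_upwards [eventually_ge_atTop 0] with t ht
    exact self_le_sinh_iff.2 (by positivity)
  have hbot : Tendsto (fun t : ℝ => sinh (π * t)) atBot atBot := by
    have := tendsto_neg_atTop_atBot.comp (htop.comp tendsto_neg_atBot_atTop)
    refine this.congr fun t => ?_
    simp
  have hd : ∀ t : ℝ, HasDerivAt (fun t => π⁻¹ * arctan (sinh (π * t))) (cosh (π * t))⁻¹ t := by
    intro t
    have h := (((hasDerivAt_id t).const_mul π).sinh.arctan).const_mul π⁻¹
    refine h.congr_deriv ?_
    have hc := cosh_sq' (π * t)
    have := (cosh_pos (π * t)).ne'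
    simp only [id, ← hc]
    field_simp
  rw [MeasureTheory.integral_of_hasDerivAt_of_tendsto hd hi
    (((tendsto_nhds_of_tendsto_nhdsWithin tendsto_arctan_atBot).comp hbot).const_mul π⁻¹)
    (((tendsto_nhds_of_tendsto_nhdsWithin tendsto_arctan_atTop).comp htop).const_mul π⁻¹)]
  field_simp
  ring

theorem tendsto_exp_neg_mul_abs {η : ℝ} (hη : 0 < η) :
    Tendsto (fun T : ℝ => exp (-(η * |T|))) atTop (nhds 0) :=
  tendsto_exp_neg_atTop_nhds_zero.comp (tendsto_abs_atTop_atTop.const_mul_atTop hη)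

/-- The integral over a vertical line does not depend on the line. -/
theorem integral_vertical_eq {f : ℂ → ℂ} {a b C η : ℝ} (hab : a ≤ b) (hη : 0 < η)
    (hf : DifferentiableOn ℂ f {s | s.re ∈ Set.Icc a b})
    (hbound : ∀ s : ℂ, s.re ∈ Set.Icc a b → ‖f s‖ ≤ C * exp (-(η * |s.im|))) :
    ∫ t : ℝ, f (a + t * Complex.I) = ∫ t : ℝ, f (b + t * Complex.I) := by
  have hint : ∀ c ∈ Set.Icc a b, MeasureTheory.Integrable fun t : ℝ => f (c + t * Complex.I) := by
    intro c hc
    have hmem : ∀ t : ℝ, (c + t * Complex.I : ℂ) ∈ {s : ℂ | s.re ∈ Set.Icc a b} := fun t => by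
      simpa using hc
    refine ((integrable_exp_neg_mul_abs hη).const_mul C).mono' ?_
      (Eventually.of_forall fun t => ?_)
    · exact (hf.continuousOn.comp_continuous (by fun_prop) hmem).aestronglyMeasurable
    · simpa using hbound _ (hmem t)
  have hver := fun c hc => MeasureTheory.intervalIntegral_tendsto_integral (hint c hc)
    tendsto_neg_atTop_atBot tendsto_id
  have hhor : ∀ g : ℝ → ℝ, (∀ T, |g T| = |T|) →
      Tendsto (fun T : ℝ => ∫ x in a..b, f (x + (g T : ℝ) * Complex.I)) atTop (nhds 0) := by
    intro g hg
    have h0 : Tendsto (fun T : ℝ => C * exp (-(η * |T|)) * |b - a|) atTop (nhds 0) := by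
      simpa using ((tendsto_exp_neg_mul_abs hη).const_mul C).mul_const |b - a|
    refine squeeze_zero_norm (fun T => ?_) h0
    refine intervalIntegral.norm_integral_le_of_norm_le_const fun x hx => ?_
    rw [Set.uIoc_of_le hab] at hx
    have := hbound (x + (g T : ℝ) * Complex.I) (by simpa using Set.Ioc_subset_Icc_self hx)
    simpa [hg] using this
  have hrect : ∀ T : ℝ, (∫ x in a..b, f (x + ((-T : ℝ) : ℂ) * Complex.I)) -
      (∫ x in a..b, f (x + (T : ℂ) * Complex.I)) +
      Complex.I • (∫ y in (-T)..T, f (b + y * Complex.I)) -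
      Complex.I • (∫ y in (-T)..T, f (a + y * Complex.I)) = 0 := by
    intro T
    have := Complex.integral_boundary_rect_eq_zero_of_differentiableOn f
      (a + ((-T : ℝ) : ℂ) * Complex.I) (b + (T : ℂ) * Complex.I) (hf.mono fun s hs => by
        have := hs.1
        simpa [Set.uIcc_of_le hab] using this)
    simpa using this
  have hlim := (((hhor (fun T => -T) (by simp)).sub (hhor id (by simp))).add
    ((hver b ⟨hab, le_rfl⟩).const_smul Complex.I)).sub
    ((hver a ⟨le_rfl, hab⟩).const_smul Complex.I)
  have h0 := tendsto_nhds_unique (hlim.congr hrect) tendsto_const_nhds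
  have : Complex.I * ((∫ t : ℝ, f (b + t * Complex.I)) - ∫ t : ℝ, f (a + t * Complex.I)) = 0 := by
    rw [← h0]; simp; ring
  simp only [mul_eq_zero, Complex.I_ne_zero, false_or] at this
  exact (sub_eq_zero.1 this).symm

theorem abs_sinh_im_le_norm_sin (z : ℂ) : |sinh z.im| ≤ ‖Complex.sin z‖ := by
  rw [← sq_le_sq₀ (abs_nonneg _) (norm_nonneg _), sq_abs, Complex.sq_norm, Complex.sin_eq,
    ← Complex.ofReal_sin, ← Complex.ofReal_cos, ← Complex.ofReal_sinh, ← Complex.ofReal_cosh,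
    ← Complex.ofReal_mul, ← Complex.ofReal_mul, Complex.normSq_add_mul_I, mul_pow, mul_pow,
    cosh_sq]
  nlinarith [sin_sq_add_cos_sq z.re, sq_nonneg (sin z.re)]

theorem exp_le_four_mul_sinh {u : ℝ} (hu : 1 ≤ u) : exp u ≤ 4 * sinh u := by
  rw [sinh_eq]
  have h1 := add_one_le_exp u
  have h2 : exp (-u) * exp u = 1 := by rw [← exp_add]; simp
  have h3 := exp_pos (-u)
  nlinarith

theorem sin_pi_mul_ne_zero_of_re_mem {s : ℂ} (hs : s.re ∈ Set.Icc (-(1 / 2) : ℝ) (1 / 2))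
    (h0 : s ≠ 0) : Complex.sin (π * s) ≠ 0 := by
  refine sin_pi_mul_ne_zero ?_
  rintro ⟨k, rfl⟩
  have h1 : (-(1 / 2) : ℝ) ≤ k := by simpa using hs.1
  have h2 : (k : ℝ) ≤ 1 / 2 := by simpa using hs.2
  have h3 : (-1 : ℝ) < k := by linarith
  have h4 : (k : ℝ) < 1 := by linarith
  norm_cast at h3 h4
  exact h0 (by exact_mod_cast (by omega : k = 0))

theorem norm_mul_inv_cosh_le {h : ℂ → ℂ} {C κ c : ℝ}
    (hb : ∀ t : ℝ, ‖h (c + t * Complex.I)‖ ≤ C * exp (κ * |t|)) (t : ℝ) :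
    ‖h (c + t * Complex.I) * ((cosh (π * t))⁻¹ : ℝ)‖ ≤
      C * (exp (κ * |t|) * (cosh (π * t))⁻¹) := by
  have := cosh_pos (π * t)
  rw [norm_mul, Complex.norm_of_nonneg (by positivity), ← mul_assoc]
  exact mul_le_mul_of_nonneg_right (hb t) (by positivity)

theorem integrable_mul_inv_cosh {h : ℂ → ℂ} {C κ c : ℝ} (hh : Continuous h) (hκ : κ < π)
    (hb : ∀ t : ℝ, ‖h (c + t * Complex.I)‖ ≤ C * exp (κ * |t|)) :
    MeasureTheory.Integrable fun t : ℝ => h (c + t * Complex.I) * ((cosh (π * t))⁻¹ : ℝ) := by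
  refine ((integrable_exp_mul_inv_cosh hκ).const_mul C).mono' ?_
    (Eventually.of_forall (norm_mul_inv_cosh_le hb))
  have hc : Continuous fun t : ℝ => (cosh (π * t))⁻¹ :=
    Continuous.inv₀ (by fun_prop) fun t => (cosh_pos _).ne'
  refine Continuous.aestronglyMeasurable ?_
  exact (hh.comp (by fun_prop)).mul (Complex.continuous_ofReal.comp hc)

theorem norm_integral_mul_inv_cosh_le {h : ℂ → ℂ} {C κ c : ℝ} (hκ : κ < π)
    (hb : ∀ t : ℝ, ‖h (c + t * Complex.I)‖ ≤ C * exp (κ * |t|)) :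
    ‖∫ t : ℝ, h (c + t * Complex.I) * ((cosh (π * t))⁻¹ : ℝ)‖ ≤
      C * ∫ t : ℝ, exp (κ * |t|) * (cosh (π * t))⁻¹ := by
  rw [← MeasureTheory.integral_const_mul]
  exact MeasureTheory.norm_integral_le_of_norm_le ((integrable_exp_mul_inv_cosh hκ).const_mul C)
    (Eventually.of_forall (norm_mul_inv_cosh_le hb))

/-- The residue theorem for `h(s) / sin(πs)` on the strip `|Re s| ≤ 1/2`. -/
theorem integral_div_cosh_add {h : ℂ → ℂ} {C κ : ℝ} (hh : Differentiable ℂ h) (hκ0 : 0 ≤ κ)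
    (hκ : κ < π)
    (hb : ∀ s : ℂ, s.re ∈ Set.Icc (-(1 / 2) : ℝ) (1 / 2) → ‖h s‖ ≤ C * exp (κ * |s.im|)) :
    (∫ t : ℝ, h ((1 / 2 : ℝ) + t * Complex.I) * ((cosh (π * t))⁻¹ : ℝ)) +
      (∫ t : ℝ, h ((-(1 / 2) : ℝ) + t * Complex.I) * ((cosh (π * t))⁻¹ : ℝ)) = 2 * h 0 := by
  set S : Set ℂ := {s | s.re ∈ Set.Icc (-(1 / 2) : ℝ) (1 / 2)} with hS
  set q : ℂ → ℂ := fun s => Complex.sin (π * s) with hq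
  have hqd : Differentiable ℂ q := by fun_prop
  have hpi : (π : ℂ) ≠ 0 := by exact_mod_cast pi_ne_zero
  have dslope_diff : ∀ g : ℂ → ℂ, Differentiable ℂ g → Differentiable ℂ (dslope g 0) := by
    intro g hg
    rw [← differentiableOn_univ] at hg ⊢
    exact (Complex.differentiableOn_dslope univ_mem).2 hg
  set f : ℂ → ℂ := fun s => dslope h 0 s / dslope q 0 s with hf
  have hq0 : ∀ s ∈ S, dslope q 0 s ≠ 0 := by
    intro s hs
    rcases eq_or_ne s 0 with rfl | h0
    · have : HasDerivAt q π 0 := by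
        have := ((hasDerivAt_id (0 : ℂ)).const_mul (π : ℂ)).csin
        simpa using this
      rw [dslope_same, this.deriv]
      exact hpi
    · rw [dslope_of_ne _ h0, slope_def_field]
      simpa [hq] using div_ne_zero (sin_pi_mul_ne_zero_of_re_mem hs h0) h0
  have hfd : DifferentiableOn ℂ f S :=
    (dslope_diff h hh).differentiableOn.div (dslope_diff q hqd).differentiableOn hq0
  have hfe : ∀ s ≠ 0, f s = (h s - h 0) / q s := by
    intro s h0
    simp only [hf, dslope_of_ne _ h0, slope_def_field]
    have : q 0 = 0 := by simp [hq]
    rw [this, sub_zero, sub_zero, div_div_div_cancel_right₀ h0]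
  set η := π - κ with hη
  have hη0 : 0 < η := sub_pos.2 hκ
  obtain ⟨M, hM⟩ := ((isCompact_Icc (a := (-(1 / 2) : ℝ)) (b := 1 / 2)).reProdIm
    (isCompact_Icc (a := (-1 : ℝ)) (b := 1))).exists_bound_of_continuousOn
      (hfd.continuousOn.mono fun s hs => hs.1)
  have hC : 0 ≤ C := by
    have := (norm_nonneg _).trans (hb 0 (by norm_num))
    simpa using this
  have hM0 : 0 ≤ M := (norm_nonneg _).trans (hM 0 (by constructor <;> norm_num))
  have hfb : ∀ s ∈ S, ‖f s‖ ≤ (M * exp η + 8 * C) * exp (-(η * |s.im|)) := by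
    intro s hs
    rw [add_mul]
    rcases le_total |s.im| 1 with h1 | h1
    · refine le_add_of_le_of_nonneg ?_ (by positivity)
      rw [mul_assoc, ← exp_add]
      refine (hM s ⟨hs, abs_le.1 h1⟩).trans (le_mul_of_one_le_right hM0 (one_le_exp ?_))
      nlinarith
    · refine le_add_of_nonneg_of_le (by positivity) ?_
      have hs0 : s ≠ 0 := by
        rintro rfl
        norm_num at h1
      have hnum : ‖h s - h 0‖ ≤ 2 * C * exp (κ * |s.im|) := by
        have h0 := hb 0 (by norm_num)
        have h2 := hb s hs
        have h3 : C * exp (κ * |(0 : ℂ).im|) ≤ C * exp (κ * |s.im|) := by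
          refine mul_le_mul_of_nonneg_left (exp_le_exp.2 ?_) hC
          simpa using mul_nonneg hκ0 (abs_nonneg s.im)
        linarith [norm_sub_le (h s) (h 0)]
      have hden : exp (π * |s.im|) ≤ 4 * ‖q s‖ := by
        have h2 := abs_sinh_im_le_norm_sin (π * s)
        rw [Complex.im_ofReal_mul, abs_sinh, abs_mul,
          abs_of_pos pi_pos] at h2
        have h3 := exp_le_four_mul_sinh (u := π * |s.im|) (by nlinarith [pi_gt_three])
        linarith
      have hq1 : 0 < ‖q s‖ := by linarith [exp_pos (π * |s.im|)]
      rw [hfe s hs0, norm_div, div_le_iff₀ hq1]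
      have hsplit : exp (κ * |s.im|) = exp (-(η * |s.im|)) * exp (π * |s.im|) := by
        rw [← exp_add, hη]; ring_nf
      calc ‖h s - h 0‖ ≤ 2 * C * exp (κ * |s.im|) := hnum
        _ = 2 * C * exp (-(η * |s.im|)) * exp (π * |s.im|) := by rw [hsplit]; ring
        _ ≤ 2 * C * exp (-(η * |s.im|)) * (4 * ‖q s‖) := by gcongr
        _ = _ := by ring
  have key := integral_vertical_eq (by norm_num) hη0 hfd hfb
  have hqr : ∀ t : ℝ, q ((1 / 2 : ℝ) + t * Complex.I) = (cosh (π * t) : ℝ) := by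
    intro t
    have : (π * ((1 / 2 : ℝ) + t * Complex.I) : ℂ) = (π * t : ℝ) * Complex.I + π / 2 := by
      push_cast; ring
    rw [hq]
    simp only
    rw [this, Complex.sin_add_pi_div_two, Complex.cos_mul_I, Complex.ofReal_cosh]
  have hql : ∀ t : ℝ, q ((-(1 / 2) : ℝ) + t * Complex.I) = -(cosh (π * t) : ℝ) := by
    intro t
    have : (π * ((-(1 / 2) : ℝ) + t * Complex.I) : ℂ) = (π * t : ℝ) * Complex.I - π / 2 := by
      push_cast; ring
    rw [hq]
    simp only
    rw [this, Complex.sin_sub_pi_div_two, Complex.cos_mul_I, Complex.ofReal_cosh]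
  have hint : ∀ c ∈ Set.Icc (-(1 / 2) : ℝ) (1 / 2), MeasureTheory.Integrable
      fun t : ℝ => h (c + t * Complex.I) * ((cosh (π * t))⁻¹ : ℝ) := by
    intro c hc
    refine integrable_mul_inv_cosh (C := C) hh.continuous hκ fun t => ?_
    simpa using hb (c + t * Complex.I) (by simpa using hc)
  have hcosh : MeasureTheory.Integrable fun t : ℝ => h 0 * (((cosh (π * t))⁻¹ : ℝ) : ℂ) := by
    refine MeasureTheory.Integrable.const_mul ?_ _
    have := integrable_exp_mul_inv_cosh pi_pos
    simp only [zero_mul, exp_zero, one_mul] at this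
    exact this.ofReal
  have hval : ∫ t : ℝ, h 0 * (((cosh (π * t))⁻¹ : ℝ) : ℂ) = h 0 := by
    rw [MeasureTheory.integral_const_mul, integral_complex_ofReal, integral_inv_cosh]
    simp
  have hne : ∀ c : ℝ, c ≠ 0 → ∀ t : ℝ, (c + t * Complex.I : ℂ) ≠ 0 := fun c hc t h0 => by
    have := congrArg Complex.re h0
    simp [hc] at this
  have hr : ∫ t : ℝ, f ((1 / 2 : ℝ) + t * Complex.I) =
      (∫ t : ℝ, h ((1 / 2 : ℝ) + t * Complex.I) * ((cosh (π * t))⁻¹ : ℝ)) - h 0 := by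
    conv_rhs => rw [← hval, ← MeasureTheory.integral_sub (hint _ (by norm_num)) hcosh]
    refine MeasureTheory.integral_congr_ae (Eventually.of_forall fun t => ?_)
    simp only
    rw [hfe _ (hne _ (by norm_num) t), hqr, Complex.ofReal_inv]
    ring
  have hl : ∫ t : ℝ, f ((-(1 / 2) : ℝ) + t * Complex.I) =
      h 0 - ∫ t : ℝ, h ((-(1 / 2) : ℝ) + t * Complex.I) * ((cosh (π * t))⁻¹ : ℝ) := by
    conv_rhs => rw [← hval, ← MeasureTheory.integral_sub hcosh (hint _ (by norm_num))]
    refine MeasureTheory.integral_congr_ae (Eventually.of_forall fun t => ?_)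
    simp only
    rw [hfe _ (hne _ (by norm_num) t), hql, Complex.ofReal_inv, div_neg]
    ring
  rw [hr, hl] at key
  linear_combination -key

theorem hasSum_alternating {h : ℂ → ℂ} {C κ : ℝ} (hh : Differentiable ℂ h) (hκ0 : 0 ≤ κ)
    (hκ : κ < π) (hC : 0 ≤ C)
    (hb : ∀ s : ℂ, -(1 / 2) ≤ s.re → ‖h s‖ ≤ C * 2 ^ (-s.re) * exp (κ * |s.im|)) :
    HasSum (fun n : ℕ => (-1) ^ n * h n)
      ((∫ t : ℝ, h ((-(1 / 2) : ℝ) + t * Complex.I) * ((cosh (π * t))⁻¹ : ℝ)) / 2) := by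
  set J : ℝ → ℂ := fun c => ∫ t : ℝ, h (c + t * Complex.I) * ((cosh (π * t))⁻¹ : ℝ) with hJ
  have hstep : ∀ n : ℕ, J (n + 1 / 2) + J (n - 1 / 2) = 2 * h n := by
    intro n
    have := integral_div_cosh_add (h := fun s => h (s + n)) (C := C * 2 ^ (1 / 2 - n : ℝ))
      (κ := κ) (hh.comp (differentiable_id.add_const _)) hκ0 hκ (fun s hs => by
        have hn : (0 : ℝ) ≤ n := n.cast_nonneg
        have h1 := hb (s + n) (by simp; linarith [hs.1])
        simp only [Complex.add_re, Complex.natCast_re, Complex.add_im, Complex.natCast_im,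
          add_zero] at h1
        refine h1.trans ?_
        gcongr
        · norm_num
        · linarith [hs.1])
    simp only [zero_add] at this
    rw [← this, hJ]
    congr 1 <;> refine MeasureTheory.integral_congr_ae (Eventually.of_forall fun t => ?_) <;>
      simp only <;> congr 2 <;> push_cast <;> ring
  have hpartial : ∀ m : ℕ, ∑ n ∈ Finset.range m, (-1) ^ n * h n =
      (J (-(1 / 2)) - (-1) ^ m * J (m - 1 / 2)) / 2 := by
    intro m
    induction m with
    | zero => simp
    | succ m ih =>
      rw [Finset.sum_range_succ, ih]
      have h1 : ((m + 1 : ℕ) : ℝ) - 1 / 2 = m + 1 / 2 := by push_cast; ring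
      rw [h1, pow_succ]
      linear_combination (-(-1 : ℂ) ^ m / 2) * hstep m
  set K := ∫ t : ℝ, exp (κ * |t|) * (cosh (π * t))⁻¹
  have hJle : ∀ m : ℕ, ‖(-1) ^ m * J (m - 1 / 2)‖ ≤
      C * 2 ^ (1 / 2 : ℝ) * (1 / 2) ^ m * K := by
    intro m
    rw [norm_mul, norm_pow, norm_neg, norm_one, one_pow, one_mul]
    refine norm_integral_mul_inv_cosh_le hκ fun t => ?_
    have h1 := hb ((m - 1 / 2 : ℝ) + t * Complex.I) (by simp)
    have h2 : (2 : ℝ) ^ (-(m - 1 / 2 : ℝ)) = 2 ^ (1 / 2 : ℝ) * (1 / 2) ^ m := by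
      rw [neg_sub, rpow_sub two_pos, rpow_natCast, one_div, inv_pow, div_eq_mul_inv]
    simp only [Complex.add_re, Complex.ofReal_re, Complex.mul_re, Complex.I_re, mul_zero,
      Complex.ofReal_im, Complex.I_im, mul_one, sub_self, add_zero, Complex.add_im,
      Complex.mul_im, zero_add, h2] at h1
    exact h1.trans (le_of_eq (by ring))
  have hgeom : Tendsto (fun m : ℕ => ((1 : ℝ) / 2) ^ m) atTop (nhds 0) :=
    tendsto_pow_atTop_nhds_zero_of_lt_one (by norm_num) (by norm_num)
  have hJ0 : Tendsto (fun m : ℕ => (-1) ^ m * J (m - 1 / 2)) atTop (nhds 0) :=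
    squeeze_zero_norm hJle (by simpa using (hgeom.const_mul (C * 2 ^ (1 / 2 : ℝ))).mul_const K)
  have hsum : Summable fun n : ℕ => (-1) ^ n * h n := by
    refine Summable.of_norm_bounded (g := fun n : ℕ => C * ((1 : ℝ) / 2) ^ n)
      ((summable_geometric_of_lt_one (by norm_num) (by norm_num)).mul_left C) fun n => ?_
    have h1 := hb n (by simp; linarith [(n.cast_nonneg : (0 : ℝ) ≤ n)])
    rw [norm_mul, norm_pow, norm_neg, norm_one, one_pow, one_mul]
    simpa [rpow_neg] using h1
  have hlim := hsum.hasSum.tendsto_sum_nat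
  simp only [hpartial] at hlim
  have hlim' := (hJ0.const_sub (J (-(1 / 2)))).div_const 2
  rw [sub_zero] at hlim'
  rw [← tendsto_nhds_unique hlim hlim']
  exact hsum.hasSum

/-- The bilateral Mittag-Leffler series, truncated on the left at `-S`, is `O(|τ| ^ (-S))`. -/
theorem exists_hasSum_le {α : ℝ} (hα : α ∈ Set.Ioo (0 : ℝ) 2) (β : ℝ) (S : ℕ) :
    ∃ K : ℝ, ∀ τ ≤ (-1 : ℝ), ∃ U : ℝ,
      HasSum (fun n : ℕ => τ ^ ((n : ℤ) - S) * (Gamma (α * ((n : ℝ) - S) + β))⁻¹) U ∧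
        |U| ≤ K * |τ| ^ (-(S : ℤ)) := by
  have hα0 := hα.1
  obtain ⟨κ', hκ1, hκ2⟩ : ∃ κ', π / 2 < κ' ∧ κ' < π / α :=
    exists_between (div_lt_div_of_pos_left pi_pos hα0 hα.2)
  have hκ : κ' * α < π := (lt_div_iff₀ hα0).1 hκ2
  have hκ0 : 0 ≤ κ' * α := by have := pi_pos; nlinarith
  set c := α * (-(1 / 2) - S) + β with hc
  obtain ⟨C₁, hC₁, hb₁⟩ := exists_rpow_mul_norm_inv_Gamma_le le_rfl hκ1 c
  simp only [one_rpow, one_mul] at hb₁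
  set K := ∫ t : ℝ, exp (κ' * α * |t|) * (cosh (π * t))⁻¹
  refine ⟨C₁ * K / 2, fun τ hτ => ?_⟩
  set x := -τ with hx
  have hx1 : 1 ≤ x := by linarith
  have hx0 : 0 < x := by linarith
  set w : ℂ → ℂ := fun s => α * (s - S) + β with hw
  set h : ℂ → ℂ := fun s => (x : ℂ) ^ (s - S) * (Complex.Gamma (w s))⁻¹ with hh
  have hwre : ∀ s, (w s).re = α * (s.re - S) + β := fun s => by simp [hw]
  have hwim : ∀ s, |(w s).im| = α * |s.im| := fun s => by simp [hw, abs_mul, abs_of_pos hα0]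
  have hxc : (x : ℂ) ≠ 0 := by exact_mod_cast hx0.ne'
  have hd : Differentiable ℂ h := by
    refine Differentiable.mul ?_ (Complex.differentiable_one_div_Gamma.comp (by fun_prop))
    exact (differentiable_id.sub_const _).const_cpow (Or.inl hxc)
  have hnorm : ∀ s, ‖h s‖ = x ^ (s.re - S) * ‖(Complex.Gamma (w s))⁻¹‖ := fun s => by
    simp [hh, Complex.norm_cpow_eq_rpow_re_of_pos hx0]
  have hwc : ∀ s : ℂ, -(1 / 2) ≤ s.re → c ≤ (w s).re := fun s hs => by
    rw [hwre, hc]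
    gcongr
  set R := (2 * x) ^ (α⁻¹) with hR
  have hR1 : 1 ≤ R := one_le_rpow (by linarith) (by positivity)
  have hR0 : 0 < R := by linarith
  obtain ⟨C₂, hC₂, hb₂⟩ := exists_rpow_mul_norm_inv_Gamma_le hR1 hκ1 c
  have hdecay : ∀ s : ℂ, -(1 / 2) ≤ s.re →
      ‖h s‖ ≤ (2 ^ (S : ℝ) * R ^ (-β) * C₂) * 2 ^ (-s.re) * exp (κ' * α * |s.im|) := by
    intro s hs
    have h1 := hb₂ (w s) (hwc s hs)
    rw [hwim, ← mul_assoc κ'] at h1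
    have h2 : x ^ (s.re - S) =
        2 ^ (S : ℝ) * R ^ (-β) * 2 ^ (-s.re) * R ^ (w s).re := by
      rw [hwre, rpow_add hR0, hR, ← rpow_mul (by positivity), ← rpow_mul (by positivity),
        ← rpow_mul (by positivity), inv_mul_cancel_left₀ hα0.ne', mul_rpow (z := s.re - S) two_pos.le hx0.le]
      have e1 : (2 * x) ^ (α⁻¹ * -β) * (2 * x) ^ (α⁻¹ * β) = 1 := by
        rw [← rpow_add (by positivity), mul_neg α⁻¹, neg_add_cancel, rpow_zero]
      have e2 : (2 : ℝ) ^ (S : ℝ) * 2 ^ (-s.re) * 2 ^ (s.re - S) = 1 := by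
        rw [← rpow_add two_pos, ← rpow_add two_pos, show (S : ℝ) + -s.re + (s.re - S) = 0 by ring,
          rpow_zero]
      linear_combination (-x ^ (s.re - S)) * e2 - (x ^ (s.re - S) * (2 : ℝ) ^ (S : ℝ) *
        2 ^ (-s.re) * 2 ^ (s.re - S)) * e1
    rw [hnorm, h2]
    calc _ = 2 ^ (S : ℝ) * R ^ (-β) * 2 ^ (-s.re) *
          (R ^ (w s).re * ‖(Complex.Gamma (w s))⁻¹‖) := by ring
      _ ≤ 2 ^ (S : ℝ) * R ^ (-β) * 2 ^ (-s.re) * (C₂ * exp (κ' * α * |s.im|)) := by gcongr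
      _ = _ := by ring
  have hs := hasSum_alternating hd hκ0 hκ (by positivity) hdecay
  set J := ∫ t : ℝ, h ((-(1 / 2) : ℝ) + t * Complex.I) * ((cosh (π * t))⁻¹ : ℝ)
  have hJ : ‖J‖ ≤ C₁ * x ^ (-(S : ℤ)) * K := by
    refine norm_integral_mul_inv_cosh_le hκ fun t => ?_
    have hre : ((-(1 / 2) : ℝ) + t * Complex.I : ℂ).re = -(1 / 2) := by simp
    have him : ((-(1 / 2) : ℝ) + t * Complex.I : ℂ).im = t := by simp
    have h1 := hb₁ (w ((-(1 / 2) : ℝ) + t * Complex.I)) (hwc _ hre.ge)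
    rw [hwim, him, ← mul_assoc κ'] at h1
    have h2 : x ^ (-(1 / 2) - S : ℝ) ≤ x ^ (-(S : ℤ)) := by
      rw [← rpow_intCast]
      refine rpow_le_rpow_of_exponent_le hx1 ?_
      push_cast
      linarith
    rw [hnorm, hre]
    calc _ ≤ x ^ (-(S : ℤ)) * (C₁ * exp (κ' * α * |t|)) := by gcongr
      _ = _ := by ring
  have hterm : ∀ n : ℕ, (-1) ^ n * h n = (((-1) ^ S *
      (τ ^ ((n : ℤ) - S) * (Gamma (α * ((n : ℝ) - S) + β))⁻¹) : ℝ) : ℂ) := by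
    intro n
    have h1 : (x : ℂ) ^ ((n : ℂ) - S) = ((x ^ ((n : ℤ) - S) : ℝ) : ℂ) := by
      rw [Complex.ofReal_zpow, ← Complex.cpow_intCast]
      push_cast
      rfl
    have h2 : w n = ((α * ((n : ℝ) - S) + β : ℝ) : ℂ) := by simp [hw]
    have h3 : τ ^ ((n : ℤ) - S) = (-1) ^ n * (-1) ^ S * x ^ ((n : ℤ) - S) := by
      rw [show τ = (-1) * x by rw [hx]; ring, mul_zpow, zpow_sub₀ (by norm_num), zpow_natCast,
        zpow_natCast, div_eq_mul_inv, ← inv_pow, inv_neg_one]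
    have h4 : (-1 : ℝ) ^ S * (-1) ^ S = 1 := by rw [← mul_pow]; simp
    have h5 : (-1 : ℝ) ^ S * (τ ^ ((n : ℤ) - S) * (Gamma (α * ((n : ℝ) - S) + β))⁻¹) =
        (-1) ^ n * (x ^ ((n : ℤ) - S) * (Gamma (α * ((n : ℝ) - S) + β))⁻¹) := by
      rw [h3]
      linear_combination ((-1) ^ n * x ^ ((n : ℤ) - S) * (Gamma (α * ((n : ℝ) - S) + β))⁻¹) * h4
    rw [h5]
    simp only [hh, h1, h2, Complex.Gamma_ofReal, Complex.ofReal_mul, Complex.ofReal_pow,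
      Complex.ofReal_neg, Complex.ofReal_one, Complex.ofReal_inv]
  simp only [hterm] at hs
  have hre := Complex.hasSum_re hs
  simp only [Complex.ofReal_re] at hre
  have hre' := hre.mul_left ((-1) ^ S)
  simp only [← mul_assoc ((-1 : ℝ) ^ S), ← mul_pow, neg_mul_neg, one_mul, one_pow] at hre'
  refine ⟨_, hre', ?_⟩
  rw [abs_mul, abs_pow, abs_neg, abs_one, one_pow, one_mul, abs_of_neg (show τ < 0 by linarith),
    ← hx]
  refine (Complex.abs_re_le_norm _).trans ?_
  rw [norm_div, Complex.norm_ofNat]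
  linarith

/-- Asymptotic expansion of the Mittag-Leffler function at `-∞`:
`E_{β₁,β₂}(τ) + ∑_{k=1}^N τ^{-k} / Γ(β₂ - β₁ k) = O(|τ|^{-(N+1)})` as `τ → -∞`. -/
theorem stmt8 (β₁ β₂ : ℝ) (hβ₁ : β₁ ∈ Set.Ioo (0 : ℝ) 2) (N : ℕ) (hN : 1 ≤ N)
    (E : ℝ → ℝ) (hE : ∀ x : ℝ, E x = ∑' k : ℕ, x ^ k * (Real.Gamma (β₁ * k + β₂))⁻¹) :
    (fun τ : ℝ => E τ +
        ∑ k ∈ Finset.Icc 1 N, τ ^ (-(k : ℤ)) * (Real.Gamma (β₂ - β₁ * k))⁻¹)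
      =O[atBot] fun τ : ℝ => |τ| ^ (-((N : ℤ) + 1)) := by
  obtain ⟨K, hK⟩ := exists_hasSum_le hβ₁ β₂ (N + 1)
  set g := (Gamma (β₂ - β₁ * (N + 1 : ℕ)))⁻¹ with hg
  refine IsBigO.of_bound (K + |g|) ?_
  filter_upwards [eventually_le_atBot (-1)] with τ hτ
  obtain ⟨U, hU, hUle⟩ := hK τ hτ
  set u : ℕ → ℝ := fun n =>
    τ ^ ((n : ℤ) - (N + 1 : ℕ)) * (Gamma (β₁ * ((n : ℝ) - (N + 1 : ℕ)) + β₂))⁻¹ with hu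
  have hsplit := hU.summable.sum_add_tsum_nat_add (N + 1)
  rw [hU.tsum_eq] at hsplit
  have htail : ∑' n, u (n + (N + 1)) = E τ := by
    rw [hE]
    refine tsum_congr fun n => ?_
    simp only [hu]
    push_cast
    rw [add_sub_cancel_right, add_sub_cancel_right, zpow_natCast]
  have hhead : ∑ n ∈ Finset.range (N + 1), u n =
      ∑ k ∈ Finset.Icc 1 (N + 1), τ ^ (-(k : ℤ)) * (Gamma (β₂ - β₁ * k))⁻¹ := by
    refine Finset.sum_bij' (fun n _ => N + 1 - n) (fun k _ => N + 1 - k) ?_ ?_ ?_ ?_ ?_ <;>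
      intro n hn <;> simp only [Finset.mem_range, Finset.mem_Icc] at hn ⊢
    · omega
    · omega
    · omega
    · omega
    · rw [Nat.cast_sub hn.le, Nat.cast_sub hn.le, neg_sub]
      simp only [hu]
      ring_nf
  rw [Finset.sum_Icc_succ_top (by omega)] at hhead
  have hexp : (-((N + 1 : ℕ) : ℤ)) = -((N : ℤ) + 1) := by push_cast; rfl
  have hmain : E τ + ∑ k ∈ Finset.Icc 1 N, τ ^ (-(k : ℤ)) * (Gamma (β₂ - β₁ * k))⁻¹ =
      U - τ ^ (-((N : ℤ) + 1)) * g := by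
    rw [← hsplit, hhead, htail, hexp, hg]
    ring
  rw [hexp] at hUle
  rw [hmain, norm_eq_abs, norm_eq_abs, abs_of_nonneg (by positivity : 0 ≤ |τ| ^ (-((N : ℤ) + 1)))]
  refine (abs_sub _ _).trans ?_
  rw [abs_mul, abs_zpow, add_mul]
  linarith [mul_comm (|τ| ^ (-((N : ℤ) + 1))) |g|]
end

section
/- Let α ∈ (0,1) and λ₁ > 0, and define E_{α,α}(x) := ∑_{k=0}^∞ x^k · (Γ(α k + α))⁻¹ for x ∈ ℝ. Then there exists C > 0, depending only on α and λ₁, such that for every λ ≥ λ₁ and every t ≥ 1, one has t^{α-1} |E_{α,α}(-λ t^α)| ≤ C λ^{-2} t^{-(α+1)}. -/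
open Real

open MeasureTheory Set Filter Topology

theorem integral_exp_neg_exp_mul_exp (c : ℝ) (hc : 0 < c) :
    Integrable (fun u : ℝ => exp (-exp u) * exp (c * u)) ∧
      ∫ u : ℝ, exp (-exp u) * exp (c * u) = Gamma c := by
  have hd : ∀ u ∈ (univ : Set ℝ), HasDerivWithinAt exp (exp u) univ u := fun u _ =>
    (Real.hasDerivAt_exp u).hasDerivWithinAt
  have hi : InjOn exp (univ : Set ℝ) := Real.exp_injective.injOn
  have him : exp '' (univ : Set ℝ) = Ioi 0 := by rw [image_univ, Real.range_exp]
  have he : (fun u : ℝ => |exp u| • (exp (-exp u) * exp u ^ (c - 1)))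
      = fun u => exp (-exp u) * exp (c * u) := by
    funext u
    rw [abs_of_pos (exp_pos u), smul_eq_mul, ← Real.exp_mul, mul_left_comm, ← Real.exp_add]
    ring_nf
  constructor
  · have := (integrableOn_image_iff_integrableOn_abs_deriv_smul MeasurableSet.univ hd hi
      (fun x => exp (-x) * x ^ (c - 1))).1 (by rw [him]; exact Real.GammaIntegral_convergent hc)
    rwa [he, integrableOn_univ] at this
  · have := integral_image_eq_integral_abs_deriv_smul MeasurableSet.univ hd hi
      (fun x => exp (-x) * x ^ (c - 1))
    rw [he, him, ← Real.Gamma_eq_integral hc, setIntegral_univ] at this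
    exact this.symm

/-- The integral of `Φ` along the upper and lower edges of the half-strip `re ζ ≥ b`, `|im ζ| ≤ π`,
together with its vertical side: the Hankel contour in the logarithmic coordinate. -/
noncomputable def hankelIntegral (Φ : ℂ → ℂ) (b : ℝ) : ℂ :=
  Complex.I * (∫ θ in (-π)..π, Φ (b + θ * Complex.I)) +
    ∫ u in Ioi b, (Φ (u + (π : ℝ) * Complex.I) - Φ (u + ((-π : ℝ) : ℂ) * Complex.I))

theorem continuous_horizontal_of_differentiableAt (Φ : ℂ → ℂ)
    (hd : ∀ ζ : ℂ, |ζ.im| ≤ π → DifferentiableAt ℂ Φ ζ) (θ : ℝ) (hθ : |θ| ≤ π) :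
    Continuous fun u : ℝ => Φ (u + θ * Complex.I) := by
  refine continuous_iff_continuousAt.2 fun u => ?_
  exact ContinuousAt.comp (g := Φ) (hd _ (by simpa using hθ)).continuousAt (by fun_prop)

theorem hankelIntegral_eq (Φ : ℂ → ℂ) (hd : ∀ ζ : ℂ, |ζ.im| ≤ π → DifferentiableAt ℂ Φ ζ)
    (L : ℂ) (K c : ℝ) (hc : 0 < c)
    (hb : ∀ u : ℝ, u ≤ 0 → ∀ θ : ℝ, |θ| ≤ π → ‖Φ (u + θ * Complex.I) - L‖ ≤ K * exp (c * u))
    (hD : Integrable fun u : ℝ =>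
      Φ (u + (π : ℝ) * Complex.I) - Φ (u + ((-π : ℝ) : ℂ) * Complex.I)) (b : ℝ) :
    hankelIntegral Φ b = 2 * π * Complex.I * L +
      ∫ u : ℝ, (Φ (u + (π : ℝ) * Complex.I) - Φ (u + ((-π : ℝ) : ℂ) * Complex.I)) := by
  have hpi := Real.pi_pos
  have hcont := continuous_horizontal_of_differentiableAt Φ hd
  have hcontV : ∀ u : ℝ, ContinuousOn (fun θ : ℝ => Φ (u + θ * Complex.I)) (uIcc (-π) π) := by
    intro u θ hθ
    rw [uIcc_of_le (by linarith)] at hθ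
    refine ContinuousAt.continuousWithinAt ?_
    refine ContinuousAt.comp (g := Φ) (hd _ ?_).continuousAt (by fun_prop)
    simpa using abs_le.2 hθ
  have hrect : ∀ a : ℝ, Complex.I * (∫ θ in (-π)..π, Φ (a + θ * Complex.I)) =
      Complex.I * (∫ θ in (-π)..π, Φ (b + θ * Complex.I)) -
        ∫ u in a..b, (Φ (u + (π : ℝ) * Complex.I) - Φ (u + ((-π : ℝ) : ℂ) * Complex.I)) := by
    intro a
    have h := Complex.integral_boundary_rect_eq_zero_of_differentiableOn Φ
      (a + ((-π : ℝ) : ℂ) * Complex.I) (b + (π : ℝ) * Complex.I) (by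
        intro ζ hζ
        refine (hd ζ ?_).differentiableWithinAt
        have := hζ.2
        simp only [mem_preimage, Complex.add_im, Complex.mul_im, Complex.ofReal_re,
          Complex.ofReal_im, Complex.I_re, Complex.I_im] at this
        norm_num at this
        rw [uIcc_of_le (by linarith)] at this
        exact abs_le.2 this)
    rw [intervalIntegral.integral_sub ((hcont π (by rw [abs_of_pos hpi])).intervalIntegrable _ _)
      ((hcont (-π) (by rw [abs_neg, abs_of_pos hpi])).intervalIntegrable _ _)]
    simp only [Complex.add_im, Complex.add_re, Complex.mul_im, Complex.mul_re, Complex.ofReal_re,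
          Complex.ofReal_im, Complex.I_re, Complex.I_im, smul_eq_mul, mul_zero, mul_one, zero_add,
          add_zero, sub_zero] at h
    linear_combination -h
  have hlim1 : Tendsto (fun a : ℝ => Complex.I * (∫ θ in (-π)..π, Φ (a + θ * Complex.I))) atBot
      (𝓝 (2 * π * Complex.I * L)) := by
    rw [tendsto_iff_norm_sub_tendsto_zero]
    have hz : Tendsto (fun a : ℝ => K * exp (c * a) * (2 * π)) atBot (𝓝 0) := by
      have : Tendsto (fun a : ℝ => exp (c * a)) atBot (𝓝 0) :=
        Real.tendsto_exp_atBot.comp (tendsto_id.const_mul_atBot hc)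
      simpa using (this.const_mul K).mul_const (2 * π)
    refine squeeze_zero' (Eventually.of_forall fun _ => norm_nonneg _) ?_ hz
    filter_upwards [eventually_le_atBot 0] with a ha
    have : Complex.I * (∫ θ in (-π)..π, Φ (a + θ * Complex.I)) - 2 * π * Complex.I * L =
        Complex.I * ∫ θ in (-π)..π, (Φ (a + θ * Complex.I) - L) := by
      rw [intervalIntegral.integral_sub (hcontV a).intervalIntegrable (by simp),
        intervalIntegral.integral_const, Complex.real_smul]
      push_cast
      ring
    rw [this, norm_mul, Complex.norm_I, one_mul]
    refine (intervalIntegral.norm_integral_le_of_norm_le_const (C := K * exp (c * a)) ?_).trans ?_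
    · intro θ hθ
      rw [uIoc_of_le (by linarith)] at hθ
      exact hb a ha θ (abs_le.2 ⟨hθ.1.le, hθ.2⟩)
    · rw [abs_of_pos (by linarith)]
      exact le_of_eq (by ring)
  have hlim2 := (tendsto_const_nhds (x := Complex.I * (∫ θ in (-π)..π, Φ (b + θ * Complex.I)))).sub
    (intervalIntegral_tendsto_integral_Iic b hD.integrableOn tendsto_id)
  have heq := tendsto_nhds_unique (hlim1.congr hrect) hlim2
  have hs := integral_add_compl (measurableSet_Iic (a := b)) hD
  rw [compl_Iic] at hs
  rw [hankelIntegral, ← hs, heq]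
  ring

/-- The integrand of Hankel's formula for `1 / Γ (1 - s)` in the logarithmic coordinate. -/
noncomputable def hankelKernel (s : ℝ) (ζ : ℂ) : ℂ := Complex.exp (Complex.exp ζ + s * ζ)

theorem cexp_add_pi (u : ℝ) : Complex.exp (u + (π : ℝ) * Complex.I) = ((-exp u : ℝ) : ℂ) := by
  rw [Complex.exp_add, Complex.exp_pi_mul_I]; simp

theorem cexp_sub_pi (u : ℝ) :
    Complex.exp (u + ((-π : ℝ) : ℂ) * Complex.I) = ((-exp u : ℝ) : ℂ) := by
  rw [Complex.exp_add, Complex.ofReal_neg, neg_mul, Complex.exp_neg, Complex.exp_pi_mul_I]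
  simp

theorem hasDerivAt_hankelKernel (s : ℝ) (ζ : ℂ) :
    HasDerivAt (hankelKernel s) (hankelKernel (s + 1) ζ + s * hankelKernel s ζ) ζ := by
  have h : HasDerivAt (fun ζ : ℂ => Complex.exp (Complex.exp ζ + s * ζ)) _ ζ :=
    ((Complex.hasDerivAt_exp ζ).add ((hasDerivAt_id ζ).const_mul (s : ℂ))).cexp
  refine h.congr_deriv ?_
  simp only [hankelKernel, Complex.ofReal_add, Complex.ofReal_one, id, Pi.add_apply]
  rw [show Complex.exp ζ + (s + 1) * ζ = (Complex.exp ζ + s * ζ) + ζ by ring,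
    Complex.exp_add _ ζ]
  ring

theorem continuous_hankelKernel (s : ℝ) : Continuous (hankelKernel s) := by
  unfold hankelKernel; fun_prop

theorem hankelKernel_add_pi (s u : ℝ) : hankelKernel s (u + (π : ℝ) * Complex.I) =
    ((exp (-exp u) * exp (s * u) : ℝ) : ℂ) * Complex.exp ((s * π : ℝ) * Complex.I) := by
  rw [hankelKernel, cexp_add_pi]
  push_cast
  rw [← Complex.exp_add, ← Complex.exp_add]
  ring_nf

theorem hankelKernel_sub_pi (s u : ℝ) : hankelKernel s (u + ((-π : ℝ) : ℂ) * Complex.I) =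
    ((exp (-exp u) * exp (s * u) : ℝ) : ℂ) * Complex.exp (-(s * π : ℝ) * Complex.I) := by
  rw [hankelKernel, cexp_sub_pi]
  push_cast
  rw [← Complex.exp_add, ← Complex.exp_add]
  ring_nf

theorem hankelKernel_sub (s u : ℝ) :
    hankelKernel s (u + (π : ℝ) * Complex.I) - hankelKernel s (u + ((-π : ℝ) : ℂ) * Complex.I) =
      ((exp (-exp u) * exp (s * u) : ℝ) : ℂ) * (2 * Complex.I * (sin (s * π) : ℝ)) := by
  rw [hankelKernel_add_pi, hankelKernel_sub_pi, ← mul_sub, Complex.exp_mul_I,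
    Complex.exp_mul_I, Complex.cos_neg, Complex.sin_neg]
  push_cast
  ring

theorem integrableOn_exp_neg_exp_mul_exp (s b : ℝ) (hb : 0 ≤ b) :
    IntegrableOn (fun u : ℝ => exp (-exp u) * exp (s * u)) (Ioi b) := by
  have h := (integral_exp_neg_exp_mul_exp (max s 1) (by positivity)).1.integrableOn (s := Ioi b)
  refine h.mono' (Continuous.aestronglyMeasurable (by fun_prop)) ?_
  filter_upwards [ae_restrict_mem measurableSet_Ioi] with u hu
  rw [Real.norm_of_nonneg (by positivity)]
  have : 0 ≤ u := hb.trans (le_of_lt hu)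
  gcongr
  exact le_max_left _ _

theorem tendsto_exp_neg_exp_mul_exp (s : ℝ) :
    Tendsto (fun u : ℝ => exp (-exp u) * exp (s * u)) atTop (𝓝 0) := by
  have h := (tendsto_rpow_mul_exp_neg_mul_atTop_nhds_zero s 1 one_pos).comp Real.tendsto_exp_atTop
  refine h.congr fun u => ?_
  simp only [Function.comp, ← Real.exp_mul]
  ring_nf

theorem hankelIntegral_hankelKernel_add_one (s b : ℝ) (hb : 0 ≤ b) :
    hankelIntegral (hankelKernel (s + 1)) b = -s * hankelIntegral (hankelKernel s) b := by
  have hk := continuous_hankelKernel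
  have hV : Complex.I * (∫ θ in (-π)..π, hankelKernel (s + 1) (b + θ * Complex.I)) +
      s * (Complex.I * (∫ θ in (-π)..π, hankelKernel s (b + θ * Complex.I))) =
      hankelKernel s (b + (π : ℝ) * Complex.I) -
        hankelKernel s (b + ((-π : ℝ) : ℂ) * Complex.I) := by
    have hder : ∀ θ : ℝ, HasDerivAt (fun θ : ℝ => hankelKernel s (b + θ * Complex.I))
        ((hankelKernel (s + 1) (b + θ * Complex.I) +
          s * hankelKernel s (b + θ * Complex.I)) * Complex.I) θ := by
      intro θ
      have h1 : HasDerivAt (fun θ : ℝ => (b : ℂ) + θ * Complex.I) Complex.I θ := by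
        simpa using ((Complex.ofRealCLM.hasDerivAt (x := θ)).mul_const Complex.I).const_add (b : ℂ)
      exact (hasDerivAt_hankelKernel s _).comp θ h1
    rw [← intervalIntegral.integral_eq_sub_of_hasDerivAt (fun θ _ => hder θ)
      (Continuous.intervalIntegrable (by fun_prop) _ _), intervalIntegral.integral_mul_const,
      intervalIntegral.integral_add (Continuous.intervalIntegrable (by fun_prop) _ _)
      (Continuous.intervalIntegrable (by fun_prop) _ _), intervalIntegral.integral_const_mul]
    ring
  have hint : ∀ s, IntegrableOn (fun u : ℝ => hankelKernel s (u + (π : ℝ) * Complex.I) -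
      hankelKernel s (u + ((-π : ℝ) : ℂ) * Complex.I)) (Ioi b) := by
    intro s
    simp only [hankelKernel_sub]
    exact ((integrableOn_exp_neg_exp_mul_exp s b hb).ofReal).mul_const _
  have hT : (∫ u in Ioi b, (hankelKernel (s + 1) (u + (π : ℝ) * Complex.I) -
      hankelKernel (s + 1) (u + ((-π : ℝ) : ℂ) * Complex.I))) +
      s * (∫ u in Ioi b, (hankelKernel s (u + (π : ℝ) * Complex.I) -
      hankelKernel s (u + ((-π : ℝ) : ℂ) * Complex.I))) =
      0 - (hankelKernel s (b + (π : ℝ) * Complex.I) -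
        hankelKernel s (b + ((-π : ℝ) : ℂ) * Complex.I)) := by
    rw [← integral_const_mul, ← integral_add (hint _) ((hint _).const_mul _)]
    refine integral_Ioi_of_hasDerivAt_of_tendsto' (f := fun u : ℝ =>
      hankelKernel s (u + (π : ℝ) * Complex.I) - hankelKernel s (u + ((-π : ℝ) : ℂ) * Complex.I))
      (fun u _ => ?_) ((hint _).add ((hint _).const_mul _)) ?_
    · have h1 : ∀ θ : ℝ, HasDerivAt (fun u : ℝ => (u : ℂ) + θ * Complex.I) 1 u := fun θ => by
        simpa using (Complex.ofRealCLM.hasDerivAt (x := u)).add_const ((θ : ℂ) * Complex.I)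
      have h2 := ((hasDerivAt_hankelKernel s _).comp u (h1 π)).sub
        ((hasDerivAt_hankelKernel s _).comp u (h1 (-π)))
      refine h2.congr_deriv ?_
      ring
    · simp only [hankelKernel_sub]
      have := ((Complex.continuous_ofReal.tendsto 0).comp
        (tendsto_exp_neg_exp_mul_exp s)).mul_const (2 * Complex.I * (sin (s * π) : ℝ))
      simpa using! this
  unfold hankelIntegral
  linear_combination hV + hT

theorem norm_exp_exp_le (u θ : ℝ) (hu : u ≤ 0) :
    ‖Complex.exp (Complex.exp (u + θ * Complex.I))‖ ≤ exp 1 := by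
  refine (Complex.norm_exp_le_exp_norm _).trans ?_
  gcongr
  rw [Complex.norm_exp]
  simpa using hu

/-- Hankel's formula for the reciprocal Gamma function. -/
theorem hankelIntegral_hankelKernel (z : ℝ) (hz : 0 < z) (b : ℝ) (hb : 0 ≤ b) :
    hankelIntegral (hankelKernel (1 - z)) b = 2 * π * Complex.I * ((Gamma z)⁻¹ : ℝ) := by
  have hdiff : ∀ s : ℝ, ∀ ζ : ℂ, |ζ.im| ≤ π → DifferentiableAt ℂ (hankelKernel s) ζ :=
    fun s ζ _ => (hasDerivAt_hankelKernel s ζ).differentiableAt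
  have hbase : ∀ z : ℝ, 0 < z → z ≤ 1 →
      hankelIntegral (hankelKernel (1 - z)) b = 2 * π * Complex.I * ((Gamma z)⁻¹ : ℝ) := by
    intro z hz hz1
    rcases hz1.lt_or_eq with hz1 | rfl
    · have hI := integral_exp_neg_exp_mul_exp (1 - z) (by linarith)
      rw [hankelIntegral_eq (hankelKernel (1 - z)) (hdiff _) 0 (exp 1) (1 - z) (by linarith)]
      · simp only [hankelKernel_sub]
        rw [integral_mul_const, integral_complex_ofReal, hI.2]
        have h := Real.Gamma_mul_Gamma_one_sub z
        have hs : sin ((1 - z) * π) = sin (π * z) := by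
          rw [show (1 - z) * π = π - π * z by ring, Real.sin_pi_sub]
        have hpos : 0 < sin (π * z) :=
          Real.sin_pos_of_pos_of_lt_pi (by positivity) (by nlinarith [Real.pi_pos])
        have hG := Real.Gamma_pos_of_pos hz
        have h' : Gamma (1 - z) * sin (π * z) = π * (Gamma z)⁻¹ := by
          rw [eq_div_iff hpos.ne'] at h
          rw [← div_eq_mul_inv, eq_div_iff hG.ne']
          linarith
        have h'' : (Gamma (1 - z) : ℂ) * (sin (π * z) : ℝ) = π * ((Gamma z)⁻¹ : ℝ) := by
          exact_mod_cast h'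
        rw [hs]
        linear_combination (2 * Complex.I) * h''
      · intro u hu θ _
        rw [sub_zero, hankelKernel, Complex.exp_add, norm_mul]
        gcongr
        · exact norm_exp_exp_le u θ hu
        · rw [Complex.norm_exp]; simp
      · simp only [hankelKernel_sub]
        exact hI.1.ofReal.mul_const _
    · rw [hankelIntegral_eq (hankelKernel (1 - 1)) (hdiff _) 1 2 1 one_pos]
      · simp only [hankelKernel_sub]
        simp
      · intro u hu θ _
        have hn : ‖Complex.exp (u + θ * Complex.I)‖ = exp u := by rw [Complex.norm_exp]; simp
        have := Complex.norm_exp_sub_one_le (x := Complex.exp (u + θ * Complex.I))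
          (by rw [hn]; simpa using hu)
        rw [hn] at this
        simpa [hankelKernel] using this
      · simp only [hankelKernel_sub]
        simp
  have hind : ∀ n : ℕ, ∀ z : ℝ, 0 < z → z ≤ n + 1 →
      hankelIntegral (hankelKernel (1 - z)) b = 2 * π * Complex.I * ((Gamma z)⁻¹ : ℝ) := by
    intro n
    induction n with
    | zero => intro z hz hz1; exact hbase z hz (by simpa using hz1)
    | succ n ih =>
      intro z hz hzn
      rcases le_or_gt z 1 with h1 | h1
      · exact hbase z hz h1
      · have h := ih (z - 1) (by linarith) (by push_cast at hzn; linarith)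
        rw [show 1 - (z - 1) = (1 - z) + 1 by ring, hankelIntegral_hankelKernel_add_one _ b hb] at h
        have hg := Real.Gamma_add_one (s := z - 1) (by linarith)
        rw [sub_add_cancel] at hg
        have hne : ((z - 1 : ℝ) : ℂ) ≠ 0 := by
          exact_mod_cast (by linarith : z - 1 ≠ 0)
        apply mul_left_cancel₀ hne
        rw [hg, mul_inv]
        push_cast at h hne ⊢
        rw [show (z : ℂ) - 1 = -(1 - z) by ring] at hne ⊢
        have hne' : (1 - z : ℂ) ≠ 0 := fun h0 => hne (by simp [h0])
        rw [h]
        field_simp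
  obtain ⟨n, hn⟩ := exists_nat_ge z
  exact hind n z hz (by linarith)

/-- The integrand of the Hankel representation of `E_{α,α}(-x)` in the logarithmic coordinate. -/
noncomputable def mittagLefflerKernel (α x : ℝ) (ζ : ℂ) : ℂ :=
  Complex.exp (Complex.exp ζ) * (Complex.exp ζ / (Complex.exp (α * ζ) + x))

theorem mul_sin_le_norm_cexp_add (α x : ℝ) (hα : α ∈ Ioo (0 : ℝ) 1) (hx : 0 < x) (ζ : ℂ)
    (hζ : |ζ.im| ≤ π) : x * sin (α * π) ≤ ‖Complex.exp (α * ζ) + x‖ := by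
  obtain ⟨h0, h1⟩ := hα
  have hcos : cos (α * π) ≤ cos (α * ζ.im) := by
    rw [← Real.cos_abs (α * ζ.im), abs_mul, abs_of_pos h0]
    refine Real.cos_le_cos_of_nonneg_of_le_pi (by positivity) ?_ (by gcongr)
    nlinarith [Real.pi_pos]
  refine le_trans (le_abs_self _) (abs_le_of_sq_le_sq' ?_ (norm_nonneg _) |> abs_le.2)
  rw [← Complex.normSq_eq_norm_sq, Complex.normSq_apply]
  simp only [Complex.add_re, Complex.add_im, Complex.exp_re, Complex.exp_im, Complex.re_ofReal_mul,
    Complex.im_ofReal_mul, Complex.ofReal_re, Complex.ofReal_im, add_zero]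
  have hρ := exp_pos (α * ζ.re)
  have h2 := mul_le_mul_of_nonneg_left hcos (mul_pos hρ hx).le
  have h3 := sq_nonneg (exp (α * ζ.re) + x * cos (α * π))
  have h4 : (exp (α * ζ.re) * cos (α * ζ.im) + x) * (exp (α * ζ.re) * cos (α * ζ.im) + x) +
      exp (α * ζ.re) * sin (α * ζ.im) * (exp (α * ζ.re) * sin (α * ζ.im)) =
      exp (α * ζ.re) ^ 2 + 2 * (exp (α * ζ.re) * x * cos (α * ζ.im)) + x ^ 2 := by
    linear_combination exp (α * ζ.re) ^ 2 * Real.sin_sq_add_cos_sq (α * ζ.im)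
  have h5 : (x * sin (α * π)) ^ 2 = x ^ 2 - x ^ 2 * cos (α * π) ^ 2 := by
    linear_combination x ^ 2 * Real.sin_sq_add_cos_sq (α * π)
  rw [h4, h5]
  nlinarith

theorem mul_sin_pos (α x : ℝ) (hα : α ∈ Ioo (0 : ℝ) 1) (hx : 0 < x) : 0 < x * sin (α * π) :=
  mul_pos hx (Real.sin_pos_of_pos_of_lt_pi (mul_pos hα.1 Real.pi_pos)
    (by nlinarith [Real.pi_pos, hα.2]))

theorem differentiableAt_mittagLefflerKernel (α x : ℝ) (hα : α ∈ Ioo (0 : ℝ) 1) (hx : 0 < x)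
    (ζ : ℂ) (hζ : |ζ.im| ≤ π) : DifferentiableAt ℂ (mittagLefflerKernel α x) ζ := by
  have hne : Complex.exp (α * ζ) + x ≠ 0 :=
    norm_pos_iff.1 ((mul_sin_pos α x hα hx).trans_le (mul_sin_le_norm_cexp_add α x hα hx ζ hζ))
  unfold mittagLefflerKernel
  fun_prop (disch := assumption)

theorem norm_mittagLefflerKernel_sub_le (α x : ℝ) (hα : α ∈ Ioo (0 : ℝ) 1) (hx : 0 < x) (u : ℝ) :
    ‖mittagLefflerKernel α x (u + (π : ℝ) * Complex.I) -
      mittagLefflerKernel α x (u + ((-π : ℝ) : ℂ) * Complex.I)‖ ≤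
      2 / (x * sin (α * π)) ^ 2 * (exp (-exp u) * exp ((1 + α) * u)) := by
  have hs := mul_sin_pos α x hα hx
  have hA := mul_sin_le_norm_cexp_add α x hα hx (u + (π : ℝ) * Complex.I)
    (by simp [abs_of_pos Real.pi_pos])
  have hB := mul_sin_le_norm_cexp_add α x hα hx (u + ((-π : ℝ) : ℂ) * Complex.I)
    (by simp [abs_of_pos Real.pi_pos])
  have hexp : ∀ θ : ℝ, ‖Complex.exp (α * (u + θ * Complex.I))‖ = exp (α * u) := by
    intro θ; rw [Complex.norm_exp]; simp
  have hAB : ‖(Complex.exp (α * (u + ((-π : ℝ) : ℂ) * Complex.I)) + x) -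
      (Complex.exp (α * (u + (π : ℝ) * Complex.I)) + x)‖ ≤ 2 * exp (α * u) := by
    rw [add_sub_add_right_eq_sub]
    refine (norm_sub_le _ _).trans ?_
    rw [hexp, hexp, two_mul]
  rw [mittagLefflerKernel, mittagLefflerKernel, cexp_add_pi, cexp_sub_pi]
  set A := Complex.exp (α * (u + (π : ℝ) * Complex.I)) + x
  set B := Complex.exp (α * (u + ((-π : ℝ) : ℂ) * Complex.I)) + x
  have hA0 : A ≠ 0 := norm_pos_iff.1 (hs.trans_le hA)
  have hB0 : B ≠ 0 := norm_pos_iff.1 (hs.trans_le hB)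
  have heq : Complex.exp ((-exp u : ℝ) : ℂ) * (((-exp u : ℝ) : ℂ) / A) -
      Complex.exp ((-exp u : ℝ) : ℂ) * (((-exp u : ℝ) : ℂ) / B) =
      Complex.exp ((-exp u : ℝ) : ℂ) * ((-exp u : ℝ) : ℂ) * ((B - A) / (A * B)) := by
    field_simp
  rw [heq, norm_mul, norm_mul, norm_div, norm_mul, Complex.norm_exp, Complex.ofReal_re,
    Complex.norm_real, norm_neg, Real.norm_of_nonneg (exp_pos u).le]
  calc exp (-exp u) * exp u * (‖B - A‖ / (‖A‖ * ‖B‖))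
      ≤ exp (-exp u) * exp u *
        (2 * exp (α * u) / ((x * sin (α * π)) * (x * sin (α * π)))) := by gcongr
    _ = _ := by
      rw [show (1 + α) * u = u + α * u by ring, Real.exp_add]
      ring

theorem norm_hankelIntegral_mittagLefflerKernel_le (α x : ℝ) (hα : α ∈ Ioo (0 : ℝ) 1) (hx : 0 < x)
    (b : ℝ) : ‖hankelIntegral (mittagLefflerKernel α x) b‖ ≤
      2 / (x * sin (α * π)) ^ 2 * Gamma (1 + α) := by
  have hs := mul_sin_pos α x hα hx
  have hd := differentiableAt_mittagLefflerKernel α x hα hx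
  have hcont := continuous_horizontal_of_differentiableAt _ hd
  have hpi : |π| ≤ π := by rw [abs_of_pos Real.pi_pos]
  have hI := integral_exp_neg_exp_mul_exp (1 + α) (by linarith [hα.1])
  have hg := hI.1.const_mul (2 / (x * sin (α * π)) ^ 2)
  have hle := norm_mittagLefflerKernel_sub_le α x hα hx
  have hD := hg.mono' (((hcont π hpi).sub (hcont (-π) (by rwa [abs_neg]))).aestronglyMeasurable)
    (Eventually.of_forall hle)
  rw [hankelIntegral_eq _ hd 0 (exp 1 / (x * sin (α * π))) 1 one_pos _ hD, mul_zero, zero_add,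
    ← hI.2, ← integral_const_mul]
  · exact norm_integral_le_of_norm_le hg (Eventually.of_forall hle)
  · intro u hu θ hθ
    have hA := mul_sin_le_norm_cexp_add α x hα hx (u + θ * Complex.I) (by simpa using hθ)
    rw [sub_zero, mittagLefflerKernel, norm_mul, norm_div, div_mul_eq_mul_div, mul_div_assoc]
    gcongr
    · exact norm_exp_exp_le u θ hu
    · rw [Complex.norm_exp]; simp

theorem hankelKernel_eq_geometric (α : ℝ) (k : ℕ) (ζ : ℂ) :
    hankelKernel (1 - (α * k + α)) ζ = Complex.exp (Complex.exp ζ) *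
      (Complex.exp ζ * Complex.exp (-(α * ζ))) * Complex.exp (-(α * ζ)) ^ k := by
  rw [hankelKernel, ← Complex.exp_nat_mul, ← Complex.exp_add, ← Complex.exp_add, ← Complex.exp_add]
  push_cast
  ring_nf

theorem norm_neg_mul_cexp_le (α x b : ℝ) (hα : 0 < α) (hx : 0 < x) (ζ : ℂ) (hζ : b ≤ ζ.re) :
    ‖-x * Complex.exp (-(α * ζ))‖ ≤ x * exp (-(α * b)) := by
  rw [norm_mul, norm_neg, Complex.norm_real, Real.norm_of_nonneg hx.le, Complex.norm_exp,
    Complex.neg_re, Complex.re_ofReal_mul]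
  gcongr

theorem hasSum_hankelKernel (α x b : ℝ) (hα : 0 < α) (hx : 0 < x)
    (hq : x * exp (-(α * b)) < 1) (ζ : ℂ) (hζ : b ≤ ζ.re) :
    HasSum (fun k : ℕ => (-x : ℂ) ^ k * hankelKernel (1 - (α * k + α)) ζ)
      (mittagLefflerKernel α x ζ) := by
  have hn := (norm_neg_mul_cexp_le α x b hα hx ζ hζ).trans_lt hq
  have h := (hasSum_geometric_of_norm_lt_one hn).mul_left (Complex.exp (Complex.exp ζ) *
      (Complex.exp ζ * Complex.exp (-(α * ζ))))
  convert! h using 1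
  · funext k
    rw [hankelKernel_eq_geometric, mul_pow]
    ring
  · rw [mittagLefflerKernel, mul_assoc]
    congr 1
    have h1 := Complex.exp_ne_zero (α * ζ)
    have h2 : 1 - -x * Complex.exp (-(α * ζ)) ≠ 0 := by
      intro h0
      rw [← sub_eq_zero.1 h0] at hn
      simp at hn
    have h3 : 1 - -x * Complex.exp (-(α * ζ)) =
        (Complex.exp (α * ζ) + x) / Complex.exp (α * ζ) := by
      rw [Complex.exp_neg]
      field_simp
      ring
    rw [h3] at h2 ⊢
    rw [inv_div, Complex.exp_neg]
    field_simp

theorem norm_pow_mul_hankelKernel_le (α x b : ℝ) (hα : 0 < α) (hx : 0 < x) (hb : 0 ≤ b)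
    (k : ℕ) (ζ : ℂ) (hζ : b ≤ ζ.re) :
    ‖(-x : ℂ) ^ k * hankelKernel (1 - (α * k + α)) ζ‖ ≤
      ‖Complex.exp (Complex.exp ζ)‖ * exp ζ.re * (x * exp (-(α * b))) ^ k := by
  rw [hankelKernel_eq_geometric, show (-x : ℂ) ^ k * (Complex.exp (Complex.exp ζ) *
      (Complex.exp ζ * Complex.exp (-(α * ζ))) * Complex.exp (-(α * ζ)) ^ k) =
      Complex.exp (Complex.exp ζ) * (Complex.exp ζ * Complex.exp (-(α * ζ))) *
        (-x * Complex.exp (-(α * ζ))) ^ k by rw [mul_pow]; ring,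
    norm_mul, norm_mul, norm_pow]
  gcongr
  · rw [← Complex.exp_add, Complex.norm_exp]
    have : 0 ≤ α * ζ.re := mul_nonneg hα.le (hb.trans hζ)
    refine Real.exp_le_exp.2 ?_
    simpa using this
  · exact norm_neg_mul_cexp_le α x b hα hx ζ hζ

theorem hasSum_hankelIntegral (α x b : ℝ) (hα : 0 < α) (hx : 0 < x) (hb : 0 ≤ b)
    (hq : x * exp (-(α * b)) < 1) :
    HasSum (fun k : ℕ => (-x : ℂ) ^ k * hankelIntegral (hankelKernel (1 - (α * k + α))) b)
      (hankelIntegral (mittagLefflerKernel α x) b) := by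
  have hk := continuous_hankelKernel
  have hgeo : Summable fun k : ℕ => (x * exp (-(α * b))) ^ k :=
    summable_geometric_of_lt_one (by positivity) hq
  have hV := intervalIntegral.hasSum_integral_of_dominated_convergence (μ := volume)
    (a := -π) (b := π)
    (F := fun (k : ℕ) (θ : ℝ) =>
      (-x : ℂ) ^ k * hankelKernel (1 - (α * k + α)) (b + θ * Complex.I))
    (f := fun θ : ℝ => mittagLefflerKernel α x (b + θ * Complex.I))
    (fun k _ => exp (exp b) * exp b * (x * exp (-(α * b))) ^ k)
    (fun k => Continuous.aestronglyMeasurable (by fun_prop))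
    (fun k => Eventually.of_forall fun θ _ => by
      refine (norm_pow_mul_hankelKernel_le α x b hα hx hb k _ (by simp)).trans ?_
      have h1 : ‖Complex.exp (Complex.exp (b + θ * Complex.I))‖ ≤ exp (exp b) := by
        refine (Complex.norm_exp_le_exp_norm _).trans (le_of_eq ?_)
        rw [Complex.norm_exp]; simp
      have h2 : (b + θ * Complex.I : ℂ).re = b := by simp
      rw [h2]
      gcongr)
    (Eventually.of_forall fun _ _ => hgeo.mul_left _)
    (by simp)
    (Eventually.of_forall fun θ _ => hasSum_hankelKernel α x b hα hx hq _ (by simp))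
  have hT := hasSum_integral_of_dominated_convergence (μ := volume.restrict (Ioi b))
    (F := fun (k : ℕ) (u : ℝ) =>
      (-x : ℂ) ^ k * (hankelKernel (1 - (α * k + α)) (u + (π : ℝ) * Complex.I) -
        hankelKernel (1 - (α * k + α)) (u + ((-π : ℝ) : ℂ) * Complex.I)))
    (f := fun u : ℝ => mittagLefflerKernel α x (u + (π : ℝ) * Complex.I) -
        mittagLefflerKernel α x (u + ((-π : ℝ) : ℂ) * Complex.I))
    (fun k u => 2 * (exp (-exp u) * exp (1 * u)) * (x * exp (-(α * b))) ^ k)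
    (fun k => Continuous.aestronglyMeasurable (by fun_prop))
    (fun k => by
      filter_upwards [ae_restrict_mem measurableSet_Ioi] with u hu
      have hle : ∀ θ : ℝ, b ≤ (u + θ * Complex.I : ℂ).re := fun θ => by simpa using le_of_lt hu
      have h1 := norm_pow_mul_hankelKernel_le α x b hα hx hb k _ (hle π)
      have h2 := norm_pow_mul_hankelKernel_le α x b hα hx hb k _ (hle (-π))
      rw [cexp_add_pi, Complex.norm_exp, Complex.ofReal_re] at h1
      rw [cexp_sub_pi, Complex.norm_exp, Complex.ofReal_re] at h2
      have h3 : ∀ θ : ℝ, (u + θ * Complex.I : ℂ).re = u := fun θ => by simp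
      rw [h3] at h1 h2
      rw [mul_sub, one_mul]
      refine (norm_sub_le _ _).trans ?_
      linarith)
    (Eventually.of_forall fun _ => hgeo.mul_left _)
    (by
      simp only [tsum_mul_left]
      exact ((integrableOn_exp_neg_exp_mul_exp 1 b hb).const_mul 2).mul_const _)
    (by
      filter_upwards [ae_restrict_mem measurableSet_Ioi] with u hu
      have hle : ∀ θ : ℝ, b ≤ (u + θ * Complex.I : ℂ).re := fun θ => by simpa using le_of_lt hu
      simp only [mul_sub]
      exact (hasSum_hankelKernel α x b hα hx hq _ (hle π)).sub
        (hasSum_hankelKernel α x b hα hx hq _ (hle (-π))))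
  have h := (hV.mul_left Complex.I).add hT
  convert! h using 1
  funext k
  rw [intervalIntegral.integral_const_mul, integral_const_mul, hankelIntegral]
  ring

/-- The decay `E_{α,α}(-x) = O(x⁻²)` of the Mittag-Leffler function on the negative half-line. -/
theorem abs_mittagLeffler_neg_le (α x : ℝ) (hα : α ∈ Ioo (0 : ℝ) 1) (hx : 0 < x) :
    |∑' k : ℕ, (-x) ^ k * (Gamma (α * k + α))⁻¹| ≤
      Gamma (1 + α) / (π * sin (α * π) ^ 2) * (x ^ 2)⁻¹ := by
  have hα0 := hα.1
  obtain ⟨b, hb, hq⟩ : ∃ b : ℝ, 0 ≤ b ∧ x * exp (-(α * b)) < 1 := by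
    refine ⟨x / α, by positivity, ?_⟩
    rw [mul_div_cancel₀ x hα0.ne', Real.exp_neg, ← div_eq_mul_inv, div_lt_one (exp_pos x)]
    linarith [Real.add_one_le_exp x]
  have h := hasSum_hankelIntegral α x b hα0 hx hb hq
  have hterm : ∀ k : ℕ, (-x : ℂ) ^ k * hankelIntegral (hankelKernel (1 - (α * k + α))) b =
      2 * π * Complex.I * (((-x) ^ k * (Gamma (α * k + α))⁻¹ : ℝ) : ℂ) := by
    intro k
    rw [hankelIntegral_hankelKernel _ (by positivity) b hb]
    push_cast
    ring
  simp only [hterm] at h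
  have h2 := h.tsum_eq
  rw [tsum_mul_left, ← Complex.ofReal_tsum] at h2
  have h3 := norm_hankelIntegral_mittagLefflerKernel_le α x hα hx b
  rw [← h2] at h3
  simp only [norm_mul, Complex.norm_I, Complex.norm_real, Complex.norm_ofNat, mul_one,
    Real.norm_eq_abs, abs_of_pos Real.pi_pos] at h3
  have hs := mul_sin_pos α 1 hα one_pos
  rw [one_mul] at hs
  rw [← mul_le_mul_iff_right₀ (show 0 < 2 * π by positivity)]
  refine h3.trans (le_of_eq ?_)
  have := Real.pi_pos
  field_simp

/-- For `α ∈ (0,1)` and `λ₁ > 0` there is `C > 0` (depending only on `α, λ₁`)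
such that `t^{α-1} |E_{α,α}(-λ t^α)| ≤ C λ^{-2} t^{-(α+1)}` for all `λ ≥ λ₁`
and `t ≥ 1`. -/
theorem stmt10 (α : ℝ) (hα : α ∈ Set.Ioo (0 : ℝ) 1) (lam1 : ℝ) (hlam1 : 0 < lam1)
    (E : ℝ → ℝ) (hE : ∀ x : ℝ, E x = ∑' k : ℕ, x ^ k * (Real.Gamma (α * k + α))⁻¹) :
    ∃ C > 0, ∀ lam t : ℝ, lam1 ≤ lam → 1 ≤ t →
      t ^ (α - 1) * |E (-(lam * t ^ α))| ≤ C * lam ^ (-2 : ℝ) * t ^ (-(α + 1)) := by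
  have hs := mul_sin_pos α 1 hα one_pos
  rw [one_mul] at hs
  have hG : 0 < Gamma (1 + α) := Real.Gamma_pos_of_pos (by linarith [hα.1])
  refine ⟨Gamma (1 + α) / (π * sin (α * π) ^ 2), by positivity, fun lam t hlam ht => ?_⟩
  have hl : 0 < lam := hlam1.trans_le hlam
  have ht0 : 0 < t := one_pos.trans_le ht
  have h := abs_mittagLeffler_neg_le α (lam * t ^ α) hα (by positivity)
  rw [← hE] at h
  refine (mul_le_mul_of_nonneg_left h (by positivity)).trans (le_of_eq ?_)
  have h1 : lam ^ (-2 : ℝ) = (lam ^ 2)⁻¹ := by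
    rw [Real.rpow_neg hl.le, Real.rpow_two]
  have h2 : t ^ (α - 1) * ((t ^ α) ^ 2)⁻¹ = t ^ (-(α + 1)) := by
    rw [← Real.rpow_two, ← Real.rpow_mul ht0.le, ← Real.rpow_neg ht0.le, ← Real.rpow_add ht0]
    ring_nf
  rw [h1, ← h2, mul_pow, mul_inv]
  ring
end
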